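/- Let k be a positive odd integer and m = Σ_{−j≤i≤j} m_{i,j}⟨i,j⟩ a θ-restricted multisegment. Then in the B_θ(gl_∞)-module Ṽ_θ(0): E_{−k}·P_θ(m)φ̃ = (1−q^2) Σ_{ℓ>k} q^{1+Σ_{ℓ'≥ℓ}(m_{−k+2,ℓ'}−m_{−k,ℓ'})}[m_{−k+2,ℓ}+1] P_θ(m − ⟨−k,ℓ⟩ + ⟨−k+2,ℓ⟩)φ̃ + (1−q^2) q^{1+Σ_{ℓ'>k}(m_{−k+2,ℓ'}−m_{−k,ℓ'}) + m_{−k+2,k} − 2m_{−k,k}}[m_{−k+2,k}+1] P_θ(m − ⟨−k,k⟩ + ⟨−k+2,k⟩)φ̃ + (1−q^2) Σ_{−k+2<i≤k−2} q^{1+Σ_{ℓ'>k}(m_{−k+2,ℓ'}−m_{−k,ℓ'}) + 2m_{−k+2,k−2} − 2m_{−k,k} + Σ_{−k+2<i'≤i}(m_{i',k−2}−m_{i',k})}[m_{i,k−2}+1] P_θ(m − ⟨i,k⟩ + ⟨i,k−2⟩)φ̃ + δ_{k≠1}(1−q^2) q^{1+Σ_{ℓ'>k}(m_{−k+2,ℓ'}−m_{−k,ℓ'})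 + 2m_{−k+2,k−2} − 2m_{−k,k}}[2(m_{−k+2,k−2}+1)] P_θ(m − ⟨−k+2,k⟩ + ⟨−k+2,k−2⟩)φ̃ + q^{Σ_{ℓ'>k}(m_{−k+2,ℓ'}−m_{−k,ℓ'}) − 2m_{−k,k} + δ_{k≠1}(1 − m_{k,k} + 2m_{−k+2,k−2} + Σ_{−k+2<i≤k−2}(m_{i,k−2}−m_{i,k}))} P_θ(m − ⟨k⟩)φ̃, where all summation indices run over odd integers. -/

import Mathlib

/-! `K = ℚ(q)` and the algebra `B_θ(gl_∞)`. -/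

noncomputable section

/-- The base field `K = ℚ(q)`. -/
abbrev K : Type := RatFunc ℚ

/-- The indeterminate `q`. -/
def q : K := RatFunc.X

/-- The `q`-integer `[n]`. -/
def qint (n : ℤ) : K := (q ^ n - q ^ (-n)) / (q - q⁻¹)

/-- The `q`-factorial `[n]!`. -/
def qfact (n : ℕ) : K := ∏ k ∈ Finset.range n, qint (k + 1)

/-- Generators of `B_θ(gl_∞)`: `E_i`, `F_i`, `T_i`, `T_i⁻¹`; the parameter `a : ℤ`
encodes the odd integer `i = 2a+1`. -/
inductive BGen : Type
  | E : ℤ → BGen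
  | F : ℤ → BGen
  | T : ℤ → BGen
  | Tinv : ℤ → BGen

/-- Generators inside the free algebra. -/
def g (x : BGen) : FreeAlgebra K BGen := FreeAlgebra.ι K x

/-- The symmetric form `(α_i, α_j)` on the simple roots of `gl_∞`:
`2` if `i = j`, `−1` if `|i − j| = 2`, `0` otherwise. -/
def ip (i j : ℤ) : ℤ := if i = j then 2 else if (i - j).natAbs = 2 then -1 else 0

/-- The defining relations of `B_θ(gl_∞)` (with `θ(i) = −i`): the `T_i` commute and are
invertible, `T_{−i} = T_i`, `T_i E_j T_i⁻¹ = q^{(α_i+α_{−i},α_j)} E_j`,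
`T_i F_j T_i⁻¹ = q^{−(α_i+α_{−i},α_j)} F_j`,
`E_i F_j = q^{−(α_i,α_j)} F_j E_i + δ_{i,j} + δ_{−i,j} T_i`, and the `q`-Serre relations
for the `E_i`'s and for the `F_i`'s.  The parameter `a : ℤ` encodes `i = 2a+1`, so that
`θ` corresponds to `a ↦ −a−1`, `|i−j| > 2 ↔ 1 < |a−b|` and `|i−j| = 2 ↔ |a−b| = 1`. -/
inductive BRel : FreeAlgebra K BGen → FreeAlgebra K BGen → Prop
  | Tcomm (a b : ℤ) : BRel (g (.T a) * g (.T b)) (g (.T b) * g (.T a))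
  | TTinv (a : ℤ) : BRel (g (.T a) * g (.Tinv a)) 1
  | TinvT (a : ℤ) : BRel (g (.Tinv a) * g (.T a)) 1
  | Ttheta (a : ℤ) : BRel (g (.T (-a - 1))) (g (.T a))
  | TE (a b : ℤ) : BRel (g (.T a) * g (.E b) * g (.Tinv a))
      (q ^ (ip (2*a+1) (2*b+1) + ip (-(2*a+1)) (2*b+1)) • g (.E b))
  | TF (a b : ℤ) : BRel (g (.T a) * g (.F b) * g (.Tinv a))
      (q ^ (-(ip (2*a+1) (2*b+1) + ip (-(2*a+1)) (2*b+1))) • g (.F b))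
  | EF (a b : ℤ) : BRel (g (.E a) * g (.F b))
      (q ^ (-(ip (2*a+1) (2*b+1))) • (g (.F b) * g (.E a))
        + (if a = b then 1 else 0) + (if -a - 1 = b then g (.T a) else 0))
  | Efar (a b : ℤ) (h : 1 < |a - b|) : BRel (g (.E a) * g (.E b)) (g (.E b) * g (.E a))
  | Eserre (a b : ℤ) (h : |a - b| = 1) :
      BRel (g (.E a) * g (.E a) * g (.E b) + g (.E b) * (g (.E a) * g (.E a)))
           ((q + q⁻¹) • (g (.E a) * g (.E b) * g (.E a)))
  | Ffar (a b : ℤ) (h : 1 < |a - b|) : BRel (g (.F a) * g (.F b)) (g (.F b) * g (.F a))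
  | Fserre (a b : ℤ) (h : |a - b| = 1) :
      BRel (g (.F a) * g (.F a) * g (.F b) + g (.F b) * (g (.F a) * g (.F a)))
           ((q + q⁻¹) • (g (.F a) * g (.F b) * g (.F a)))

/-- The algebra `B_θ(gl_∞)`. -/
abbrev U : Type := RingQuot BRel

/-- The generator `E_i` for an odd integer `i`. -/
def Ee (i : ℤ) : U := RingQuot.mkAlgHom K BRel (g (.E ((i - 1) / 2)))

/-- The generator `F_i` for an odd integer `i`; this is also the image of
`f_i ∈ U_q^-(gl_∞)` under `f_i ↦ F_i`. -/
def fgen (i : ℤ) : U := RingQuot.mkAlgHom K BRel (g (.F ((i - 1) / 2)))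

/-- The generator `T_i` for an odd integer `i`. -/
def Tt (i : ℤ) : U := RingQuot.mkAlgHom K BRel (g (.T ((i - 1) / 2)))

/-- `segAux i n` is the segment `⟨i, i+2n⟩` (built from the `F` generators). -/
def segAux (i : ℤ) : ℕ → U
  | 0 => fgen i
  | n + 1 => segAux i n * fgen (i + 2 * (n + 1)) - q • (fgen (i + 2 * (n + 1)) * segAux i n)

/-- The segment `⟨i,j⟩` for odd `i ≤ j`. -/
def seg (i j : ℤ) : U := segAux i ((j - i) / 2).toNat

/-- The divided power `⟨i,j⟩^{(n)}` (zero for `n < 0`). -/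
def segPow (i j : ℤ) (n : ℤ) : U :=
  if n < 0 then 0 else (qfact n.toNat)⁻¹ • seg i j ^ n.toNat

/-- The modified divided power `⟨i,j⟩^{[n]}`. -/
def segPowM (i j : ℤ) (n : ℤ) : U :=
  if i = -j then
    (if n < 0 then 0 else (∏ ν ∈ Finset.range n.toNat, qint (2 * (ν + 1)))⁻¹ • seg i j ^ n.toNat)
  else segPow i j n


open scoped Classical

/-- Multisegments as elements of the free abelian group on the segments `⟨i,j⟩`. -/
abbrev MS : Type := (ℤ × ℤ) →₀ ℤ

/-- The segment `⟨i,j⟩` viewed as a multisegment. -/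
def sg (i j : ℤ) : MS := Finsupp.single (i, j) 1

/-- `m` is a multisegment: supported on pairs of odd integers `i ≤ j`,
with nonnegative multiplicities. -/
def IsMulti (m : MS) : Prop :=
  ∀ i j : ℤ, m (i, j) ≠ 0 → Odd i ∧ Odd j ∧ i ≤ j ∧ 0 < m (i, j)

/-- `m` is a θ-restricted multisegment (`m_{i,j} = 0` unless `−j ≤ i ≤ j`). -/
def IsTheta (m : MS) : Prop :=
  ∀ i j : ℤ, m (i, j) ≠ 0 → Odd i ∧ Odd j ∧ -j ≤ i ∧ i ≤ j ∧ 0 < m (i, j)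

/-- The pairs `(i,j)` in the box `[-N,N]²`, listed in decreasing PBW order,
i.e. decreasing lexicographic order in `(j,i)`. -/
def box (N : ℕ) : List (ℤ × ℤ) :=
  (List.range (2 * N + 1)).flatMap fun a =>
    (List.range (2 * N + 1)).map fun b => (((N : ℤ) - b, (N : ℤ) - a))

/-- A bound on the support of `m`. -/
def bound (m : MS) : ℕ := m.support.sup fun p => max p.1.natAbs p.2.natAbs

/-- The product of the modified divided powers `⟨i,j⟩^{[m_{i,j}]}` over the segments
appearing in `m`, in decreasing PBW order. -/
def PthetaProd (m : MS) : U := ((box (bound m)).map fun p => segPowM p.1 p.2 (m p)).prod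

/-- `P_θ(m)` for a θ-restricted multisegment `m`; it is `0` if `m` is not a
θ-restricted multisegment. -/
def Ptheta (m : MS) : U := if IsTheta m then PthetaProd m else 0

/-- The left ideal `Σ_i (B_θ(gl_∞)E_i + B_θ(gl_∞)(T_i − 1) + B_θ(gl_∞)(F_i − F_{−i}))`
(over odd `i`). -/
def Jideal : Ideal U := Ideal.span
  {x : U | ∃ i : ℤ, Odd i ∧ (x = Ee i ∨ x = Tt i - 1 ∨ x = fgen i - fgen (-i))}

/-- The `B_θ(gl_∞)`-module `Ṽ_θ(0)`. -/
abbrev Vt : Type := U ⧸ Jideal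

/-- The generator `φ̃ ∈ Ṽ_θ(0)`, image of `1`. -/
def phi : Vt := Submodule.Quotient.mk 1

section QCommutation

/-- `module` needs the standard `ℕ`-algebra structure on `K`. -/
local instance algebraNatK : Algebra ℕ K := Semiring.toNatAlgebra

/-- `module` needs the standard `ℤ`-algebra structure on `K`. -/
local instance algebraIntK : Algebra ℤ K := Ring.toIntAlgebra K

variable {A : Type*} [Ring A] [Algebra K A]

/-- `x` and `y` commute up to the factor `q ^ e`. -/
def QComm (e : ℤ) (x y : A) : Prop := x * y = q ^ e • (y * x)

/-- The `q`-commutator. -/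
def qbr (x y : A) : A := x * y - q • (y * x)

theorem q_ne_zero : q ≠ 0 := RatFunc.X_ne_zero

theorem q_pow_ne_one {n : ℕ} (hn : n ≠ 0) : q ^ n ≠ 1 := by
  intro h
  have h1 : algebraMap (Polynomial ℚ) (RatFunc ℚ) (Polynomial.X ^ n) =
      algebraMap (Polynomial ℚ) (RatFunc ℚ) 1 := by
    rw [map_pow, RatFunc.algebraMap_X, map_one]; exact h
  have h2 := congrArg Polynomial.natDegree (RatFunc.algebraMap_injective ℚ h1)
  simp at h2
  exact hn h2

theorem one_add_q_sq_ne_zero : 1 + q ^ 2 ≠ 0 := by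
  intro h
  apply q_pow_ne_one (n := 4) (by norm_num)
  linear_combination (q ^ 2 - 1) * h

theorem q_sub_inv_ne_zero : q - q⁻¹ ≠ 0 := by
  intro h
  apply q_pow_ne_one (n := 2) (by norm_num)
  have h1 := congrArg (fun x => q * x) h
  simp only [mul_sub, mul_inv_cancel₀ q_ne_zero, mul_zero] at h1
  linear_combination h1

theorem qint_ne_zero {n : ℤ} (hn : 0 < n) : qint n ≠ 0 := by
  intro h
  rw [qint, div_eq_zero_iff, or_iff_left q_sub_inv_ne_zero, sub_eq_zero] at h
  obtain ⟨k, rfl⟩ := Int.eq_ofNat_of_zero_le hn.le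
  apply q_pow_ne_one (n := 2 * k) (by omega)
  have h1 := congrArg (fun x => q ^ (k : ℤ) * x) h
  simp only [← zpow_add₀ q_ne_zero, add_neg_cancel, zpow_zero] at h1
  rw [← h1, ← zpow_natCast]
  congr 1
  push_cast
  ring

theorem qint_one : qint 1 = 1 := by
  rw [qint, zpow_one, zpow_neg_one, div_self q_sub_inv_ne_zero]

theorem qint_succ (n : ℤ) : qint (n + 1) = q ^ n + q⁻¹ * qint n := by
  have h := q_sub_inv_ne_zero
  have hq := q_ne_zero
  rw [qint, qint, div_eq_iff h, add_mul, mul_assoc, div_mul_cancel₀ _ h]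
  simp only [neg_add, zpow_add₀ hq, zpow_one, zpow_neg_one]
  ring

theorem qint_succ' (n : ℤ) : qint (n + 1) = q ^ (-n) + q * qint n := by
  have h := q_sub_inv_ne_zero
  have hq := q_ne_zero
  rw [qint, qint, div_eq_iff h, add_mul, mul_assoc, div_mul_cancel₀ _ h]
  simp only [neg_add, zpow_add₀ hq, zpow_one, zpow_neg_one]
  ring

theorem QComm.symm {e : ℤ} {x y : A} (h : QComm e x y) : QComm (-e) y x := by
  unfold QComm at *
  rw [h, smul_smul, ← zpow_add₀ q_ne_zero]
  simp

theorem QComm.congr {e e' : ℤ} {x y : A} (h : QComm e x y) (he : e = e') : QComm e' x y :=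
  he ▸ h

theorem QComm.one_right (x : A) : QComm 0 x 1 := by simp [QComm]

theorem QComm.one_left (x : A) : QComm 0 1 x := by simp [QComm]

theorem QComm.zero_right (e : ℤ) (x : A) : QComm e x 0 := by simp [QComm]

theorem QComm.refl (x : A) : QComm 0 x x := by simp [QComm]

theorem QComm.eq {x y : A} (h : QComm 0 x y) : x * y = y * x := by
  simpa [QComm] using h

theorem QComm.mul_right {d e : ℤ} {x y z : A} (h : QComm d x y) (h' : QComm e x z) :
    QComm (d + e) x (y * z) := by
  unfold QComm at *
  rw [← mul_assoc, h, smul_mul_assoc, mul_assoc, h', mul_smul_comm, smul_smul,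
    ← zpow_add₀ q_ne_zero, mul_assoc]

theorem QComm.sub_right {e : ℤ} {x y z : A} (h : QComm e x y) (h' : QComm e x z) :
    QComm e x (y - z) := by
  unfold QComm at *
  rw [mul_sub, h, h', sub_mul, smul_sub]

theorem QComm.smul_right {e : ℤ} {x y : A} (c : K) (h : QComm e x y) : QComm e x (c • y) := by
  unfold QComm at *
  rw [mul_smul_comm, h, smul_mul_assoc, smul_comm]

theorem QComm.qbr_right {d e : ℤ} {x y z : A} (h : QComm d x y) (h' : QComm e x z) :
    QComm (d + e) x (qbr y z) :=
  (h.mul_right h').sub_right (((h'.mul_right h).congr (add_comm _ _)).smul_right _)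

theorem QComm.mul_left {d e : ℤ} {x y z : A} (h : QComm d x z) (h' : QComm e y z) :
    QComm (d + e) (x * y) z :=
  ((h.symm.mul_right h'.symm).symm).congr (by ring)

theorem QComm.qbr_left {d e : ℤ} {x y z : A} (h : QComm d x z) (h' : QComm e y z) :
    QComm (d + e) (qbr x y) z :=
  ((h.symm.qbr_right h'.symm).symm).congr (by ring)

theorem QComm.pow_right {e : ℤ} {x y : A} (h : QComm e x y) (n : ℕ) :
    QComm (e * n) x (y ^ n) := by
  induction n with
  | zero => simpa using QComm.one_right x
  | succ n ih => rw [pow_succ]; exact (ih.mul_right h).congr (by push_cast; ring)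

theorem qbr_assoc {x y z : A} (h : QComm 0 x z) : qbr (qbr x y) z = qbr x (qbr y z) := by
  have h1 := h.eq
  simp only [qbr, mul_sub, sub_mul, smul_sub, mul_smul_comm, smul_mul_assoc, mul_assoc]
  rw [← mul_assoc z x y, ← h1, mul_assoc, h1]
  module

/-- The `q`-Serre relation says that `x` and the `q`-commutator of `x`, `y` `q`-commute. -/
theorem qcomm_left_qbr {x y : A}
    (h : x * x * y + y * (x * x) = (q + q⁻¹) • (x * y * x)) : QComm (-1) x (qbr x y) := by
  have hq := q_ne_zero
  simp only [QComm, qbr, mul_sub, sub_mul, smul_sub, mul_smul_comm, smul_mul_assoc, mul_assoc,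
    zpow_neg_one, smul_smul, inv_mul_cancel₀ hq, one_smul] at *
  linear_combination (norm := module) h

theorem qcomm_qbr_right {x y : A}
    (h : y * y * x + x * (y * y) = (q + q⁻¹) • (y * x * y)) : QComm (-1) (qbr x y) y := by
  have hq := q_ne_zero
  simp only [QComm, qbr, mul_sub, sub_mul, smul_sub, mul_smul_comm, smul_mul_assoc, mul_assoc,
    zpow_neg_one, smul_smul, inv_mul_cancel₀ hq, one_smul] at *
  linear_combination (norm := module) h

theorem qcomm_middle {x y z : A} (hxz : QComm 0 x z) (hxy : QComm (-1) (qbr x y) y)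
    (hyz : QComm (-1) y (qbr y z)) : QComm 0 y (qbr (qbr x y) z) := by
  have hq := q_ne_zero
  have hxy' : y * qbr x y = q • (qbr x y * y) := by
    simpa [QComm] using hxy.symm
  have hyz' : qbr y z * y = q • (y * qbr y z) := by
    simpa [QComm] using hyz.symm
  have e1 : y * qbr (qbr x y) z = q ^ 2 • (qbr (qbr x y) z * y)
      + q • (qbr x y * qbr y z - qbr y z * qbr x y) := by
    have a1 : y * qbr (qbr x y) z = (y * qbr x y) * z - q • (y * z * qbr x y) := by
      rw [qbr, mul_sub, mul_smul_comm, mul_assoc, mul_assoc]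
    have a2 : q • (qbr (qbr x y) z * y) = q • (qbr x y * z * y) - q • (z * (y * qbr x y)) := by
      rw [hxy', qbr, sub_mul, smul_mul_assoc, mul_smul_comm, smul_sub, mul_assoc z]
    rw [a1, sq, ← smul_smul, a2, hxy']
    generalize qbr x y = P at hxy' ⊢
    simp only [hxy', qbr, mul_sub, sub_mul, smul_sub, mul_smul_comm, smul_mul_assoc, mul_assoc]
    module
  have e2 : qbr (qbr x y) z * y = q ^ 2 • (y * qbr (qbr x y) z)
      + q • (qbr x y * qbr y z - qbr y z * qbr x y) := by
    rw [qbr_assoc hxz]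
    have a1 : qbr x (qbr y z) * y = x * (q • (y * qbr y z)) - q • (qbr y z * x * y) := by
      rw [qbr, sub_mul, smul_mul_assoc, mul_assoc, hyz']
    have a2 : q • (y * qbr x (qbr y z)) = q • (y * x * qbr y z) - q • ((qbr y z * y) * x) := by
      rw [hyz', qbr, mul_sub, smul_mul_assoc, mul_smul_comm, smul_sub, mul_assoc y, mul_assoc]
    rw [a1, sq, ← smul_smul, a2]
    generalize qbr y z = P
    simp only [qbr, mul_sub, sub_mul, smul_sub, mul_smul_comm, smul_mul_assoc, mul_assoc]
    module
  have e3 : (1 + q ^ 2) • (y * qbr (qbr x y) z - qbr (qbr x y) z * y) = 0 := by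
    linear_combination (norm := module) e1 - e2
  have e4 := (smul_eq_zero_iff_right one_add_q_sq_ne_zero).1 e3
  simpa [QComm, sub_eq_zero] using e4

end QCommutation

section Powers

attribute [local instance] algebraNatK algebraIntK

variable {A : Type*} [Ring A] [Algebra K A]

theorem q_zpow_mul_self (n : ℤ) : q ^ n * q = q ^ (n + 1) := (zpow_add_one₀ q_ne_zero n).symm

/-- Divided powers of `x` with respect to the quantum integers `d ν`. -/
def dpow (d : ℕ → K) (x : A) (n : ℤ) : A :=
  if n < 0 then 0 else (∏ ν ∈ Finset.range n.toNat, d ν)⁻¹ • x ^ n.toNat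

theorem dpow_natCast (d : ℕ → K) (x : A) (n : ℕ) :
    dpow d x n = (∏ ν ∈ Finset.range n, d ν)⁻¹ • x ^ n := by
  simp [dpow]

theorem dpow_zero (d : ℕ → K) (x : A) : dpow d x 0 = 1 := by simp [dpow]

theorem dpow_of_neg (d : ℕ → K) (x : A) {n : ℤ} (hn : n < 0) : dpow d x n = 0 := by
  simp [dpow, hn]

theorem mul_dpow {d : ℕ → K} (hd : ∀ ν, d ν ≠ 0) (x : A) (n : ℕ) :
    x * dpow d x n = d n • dpow d x (n + 1) := by
  rw [dpow_natCast, show ((n : ℤ) + 1) = ((n + 1 : ℕ) : ℤ) by push_cast; rfl, dpow_natCast,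
    Finset.prod_range_succ, mul_inv, smul_smul, mul_comm (d n), mul_assoc,
    inv_mul_cancel₀ (hd n), mul_one, mul_smul_comm, pow_succ']

theorem dpow_succ {d : ℕ → K} (x : A) (n : ℕ) :
    dpow d x (n + 1) = ((∏ ν ∈ Finset.range n, d ν)⁻¹ * (d n)⁻¹) • x ^ (n + 1) := by
  rw [show ((n : ℤ) + 1) = ((n + 1 : ℕ) : ℤ) by push_cast; rfl, dpow_natCast,
    Finset.prod_range_succ, mul_inv]

theorem QComm.dpow_right {e : ℤ} {x y : A} (h : QComm e x y) (d : ℕ → K) {n : ℤ} (hn : 0 ≤ n) :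
    QComm (e * n) x (dpow d y n) := by
  obtain ⟨n, rfl⟩ := Int.eq_ofNat_of_zero_le hn
  rw [dpow_natCast]
  exact (h.pow_right n).smul_right _

theorem QComm.dpow_left {e : ℤ} {x y : A} (h : QComm e x y) (d : ℕ → K) {n : ℤ} (hn : 0 ≤ n) :
    QComm (e * n) (dpow d x n) y :=
  ((h.symm.dpow_right d hn).symm).congr (by ring)

/-- The quantum integers used for ordinary divided powers. -/
def qnum (ν : ℕ) : K := qint (ν + 1)

/-- The quantum integers used for the modified divided powers of `⟨-j,j⟩`. -/
def qnumEven (ν : ℕ) : K := qint (2 * (ν + 1))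

theorem qnum_ne_zero (ν : ℕ) : qnum ν ≠ 0 := qint_ne_zero (by positivity)

theorem qnumEven_ne_zero (ν : ℕ) : qnumEven ν ≠ 0 := qint_ne_zero (by positivity)

theorem E_mul_pow_right {c : ℤ} {E x y : A} (h : E * x = q ^ c • (x * E) + y)
    (hy : QComm (c - 2) y x) (n : ℕ) :
    E * x ^ (n + 1) = q ^ (c * (n + 1)) • (x ^ (n + 1) * E)
      + (q ^ ((c - 1) * n) * qint (n + 1)) • (x ^ n * y) := by
  induction n with
  | zero => simp [h, qint_one]
  | succ n ih =>
    have hq := q_ne_zero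
    have h1 : q ^ ((c - 1) * ((n + 1 : ℕ) : ℤ)) * qint (((n + 1 : ℕ) : ℤ) + 1)
        = q ^ (c * ((n : ℤ) + 1)) + q ^ ((c - 1) * n) * qint (n + 1) * q ^ (c - 2) := by
      push_cast
      rw [qint_succ, mul_add, ← zpow_add₀ hq]
      congr 1
      · congr 1; ring
      · rw [← zpow_neg_one, ← mul_assoc, ← zpow_add₀ hq, mul_right_comm, ← zpow_add₀ hq]
        congr 2; ring
    rw [pow_succ x (n + 1), ← mul_assoc, ih, h1, add_mul, smul_mul_assoc, smul_mul_assoc,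
      mul_assoc, h, mul_assoc, show y * x = _ from hy, mul_add (x ^ (n + 1)), mul_smul_comm, mul_smul_comm,
      show c * ((n + 1 : ℕ) + 1 : ℤ) = c * (n + 1) + c by push_cast; ring, zpow_add₀ hq]
    simp only [pow_succ x, mul_assoc]
    module

theorem E_mul_dpow_right {c : ℤ} {E x y : A} (h : E * x = q ^ c • (x * E) + y)
    (hy : QComm (c - 2) y x) {n : ℤ} (hn : 0 ≤ n) :
    E * dpow qnum x n = q ^ (c * n) • (dpow qnum x n * E)
      + q ^ ((c - 1) * (n - 1)) • (dpow qnum x (n - 1) * y) := by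
  obtain ⟨n, rfl⟩ := Int.eq_ofNat_of_zero_le hn
  cases n with
  | zero => simp [dpow_zero, dpow_of_neg]
  | succ n =>
    have h0 : qint ((n : ℤ) + 1) ≠ 0 := qnum_ne_zero n
    simp only [Nat.cast_add, Nat.cast_one, add_sub_cancel_right]
    rw [dpow_succ, dpow_natCast, mul_smul_comm, E_mul_pow_right h hy n, qnum]
    simp only [smul_add, smul_smul, smul_mul_assoc]
    congr 2
    · ring
    · field_simp

theorem E_mul_pow_left {E x y : A} (h : E * x = q ^ (-1 : ℤ) • (x * E) + y)
    (hy : QComm (-1) x y) (n : ℕ) :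
    E * x ^ (n + 1) = q ^ (-(n + 1 : ℤ)) • (x ^ (n + 1) * E)
      + (q ^ (-n : ℤ) * qint (n + 1)) • (y * x ^ n) := by
  induction n with
  | zero => simp [h, qint_one]
  | succ n ih =>
    have hq := q_ne_zero
    have hpow : QComm (-(n + 1)) (x ^ (n + 1)) y :=
      ((hy.symm.pow_right (n + 1)).symm).congr (by push_cast; ring)
    have h1 : q ^ (-((n + 1 : ℕ) : ℤ)) * qint (((n + 1 : ℕ) : ℤ) + 1)
        = q ^ (-(n + 1 : ℤ)) * q ^ (-(n + 1 : ℤ)) + q ^ (-n : ℤ) * qint (n + 1) := by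
      push_cast
      rw [qint_succ', mul_add, ← mul_assoc, q_zpow_mul_self]
      congr 3; ring
    rw [pow_succ x (n + 1), ← mul_assoc, ih, h1, add_mul, smul_mul_assoc, smul_mul_assoc,
      mul_assoc, h, mul_add (x ^ (n + 1)), show x ^ (n + 1) * y = _ from hpow, mul_smul_comm,
      show -(((n + 1 : ℕ) : ℤ) + 1) = -(n + 1) + -1 by push_cast; ring, zpow_add₀ hq _ (-1)]
    simp only [pow_succ x, mul_assoc]
    module

theorem E_mul_dpow_left {E x y : A} (h : E * x = q ^ (-1 : ℤ) • (x * E) + y)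
    (hy : QComm (-1) x y) {n : ℤ} (hn : 0 ≤ n) :
    E * dpow qnum x n = q ^ (-n) • (dpow qnum x n * E)
      + q ^ (1 - n) • (y * dpow qnum x (n - 1)) := by
  obtain ⟨n, rfl⟩ := Int.eq_ofNat_of_zero_le hn
  cases n with
  | zero => simp [dpow_zero, dpow_of_neg]
  | succ n =>
    have h0 : qint ((n : ℤ) + 1) ≠ 0 := qnum_ne_zero n
    simp only [Nat.cast_add, Nat.cast_one, add_sub_cancel_right]
    rw [dpow_succ, dpow_natCast, mul_smul_comm, E_mul_pow_left h hy n, qnum]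
    simp only [smul_add, smul_smul, mul_smul_comm, smul_mul_assoc]
    congr 2
    · ring
    · rw [show (1 : ℤ) - (n + 1) = -n by ring]
      field_simp

variable {V : Type*} [AddCommGroup V] [Module K V] [Module A V] [IsScalarTower K A V]

theorem E_mul_pow_even {E T x y w : A} {t : ℤ} {u : V}
    (h : E * x = q ^ (-1 : ℤ) • (x * E) + (1 - q ^ 2) • y
      + (q ^ (-1 : ℤ) * (1 - q ^ 2)) • (w * T))
    (hxy : QComm (-1) x y) (hwx : QComm (-1) w x) (hTx : QComm (-2) T x)
    (hE : E • u = 0) (hT : T • u = q ^ t • u) (hw : w • u = q ^ (-1 - t) • y • u) (n : ℕ) :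
    E • x ^ (n + 1) • u
      = ((1 - q ^ 2) * q ^ (-1 - 2 * n : ℤ) * qint (2 * (n + 1))) • y • x ^ n • u := by
  have hq := q_ne_zero
  have key : ∀ n : ℕ, w • T • x ^ n • u = q ^ (-4 * n - 1 : ℤ) • y • x ^ n • u := by
    intro n
    have h1 : QComm (-2 * n) T (x ^ n) := hTx.pow_right n
    have h2 : QComm (-1 * n) w (x ^ n) := hwx.pow_right n
    have h3 : QComm (-1 * n) (x ^ n) y := ((hxy.symm.pow_right n).symm).congr (by ring)
    unfold QComm at h1 h2 h3
    rw [smul_smul T, h1, smul_assoc, mul_smul, hT, smul_comm (x ^ n) (q ^ t) u,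
      smul_comm w (q ^ _), smul_comm w (q ^ t), smul_smul w, h2, smul_assoc, mul_smul, hw,
      smul_comm (x ^ n) (q ^ _), smul_smul (x ^ n), h3, smul_assoc, mul_smul]
    simp only [smul_smul, ← zpow_add₀ hq]
    congr 2; ring
  induction n with
  | zero =>
    have h0 := key 0
    simp only [pow_zero, one_smul, Nat.cast_zero, mul_zero, zero_sub] at h0
    rw [zero_add, pow_one, smul_smul, h, add_smul, add_smul, smul_assoc, smul_assoc, smul_assoc,
      mul_smul x, mul_smul (_ : K), mul_smul w, hE, h0, pow_zero, one_smul]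
    simp only [smul_zero, zero_add, Nat.cast_zero, mul_zero, sub_zero, mul_one, smul_smul]
    rw [show (2 : ℤ) = 1 + 1 by norm_num, qint_succ, qint_one, ← add_smul]
    congr 1
    rw [zpow_one, zpow_neg_one]
    field_simp
  | succ n ih =>
    have h3 : x * y = q ^ (-1 : ℤ) • (y * x) := hxy
    rw [pow_succ' x (n + 1), mul_smul x, smul_smul E x, h, add_smul, add_smul, smul_assoc,
      smul_assoc, smul_assoc, mul_smul x E, mul_smul w, key (n + 1), ih, smul_comm x (_ : K),
      smul_smul x y, h3, smul_assoc, mul_smul y x, smul_smul x (x ^ n), ← pow_succ']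
    simp only [smul_smul, ← add_smul]
    congr 1
    push_cast
    rw [show (2 : ℤ) * (n + 1 + 1) = 2 * (n + 1) + 1 + 1 by ring, qint_succ', qint_succ]
    rw [show (-1 - 2 * (n : ℤ)) = -1 + -n + -n by ring,
      show (-1 - 2 * ((n : ℤ) + 1)) = -1 + -1 + -1 + -n + -n by ring,
      show -(2 * ((n : ℤ) + 1) + 1) = -1 + -1 + -1 + -n + -n by ring,
      show 2 * ((n : ℤ) + 1) = 1 + 1 + n + n by ring,
      show (-4 * ((n : ℤ) + 1) - 1) = -1 + -1 + -1 + -1 + -1 + -n + -n + -n + -n by ring]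
    simp only [zpow_add₀ hq, zpow_neg, zpow_one]
    have hn : q ^ (n : ℤ) ≠ 0 := zpow_ne_zero _ hq
    field_simp
    ring

theorem E_mul_dpow_even {E T x y w : A} {t : ℤ} {u : V}
    (h : E * x = q ^ (-1 : ℤ) • (x * E) + (1 - q ^ 2) • y
      + (q ^ (-1 : ℤ) * (1 - q ^ 2)) • (w * T))
    (hxy : QComm (-1) x y) (hwx : QComm (-1) w x) (hTx : QComm (-2) T x)
    (hE : E • u = 0) (hT : T • u = q ^ t • u) (hw : w • u = q ^ (-1 - t) • y • u)
    {n : ℤ} (hn : 0 ≤ n) :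
    E • dpow qnumEven x n • u
      = ((1 - q ^ 2) * q ^ (1 - 2 * n)) • y • dpow qnumEven x (n - 1) • u := by
  obtain ⟨n, rfl⟩ := Int.eq_ofNat_of_zero_le hn
  cases n with
  | zero => simp [dpow_zero, dpow_of_neg, hE]
  | succ n =>
    have h0 : qint (2 * ((n : ℤ) + 1)) ≠ 0 := qnumEven_ne_zero n
    simp only [Nat.cast_add, Nat.cast_one, add_sub_cancel_right]
    rw [dpow_succ, dpow_natCast, smul_assoc, smul_comm E (_ : K),
      E_mul_pow_even h hxy hwx hTx hE hT hw n, qnumEven, smul_assoc _ (x ^ n) u, smul_comm y (_ : K)]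
    simp only [smul_smul]
    congr 1
    rw [show (1 : ℤ) - 2 * (n + 1) = -1 - 2 * n by ring]
    field_simp

end Powers

section Segments

attribute [local instance] algebraNatK algebraIntK

/-- The generator `F_{2a+1}`. -/
def ff (a : ℤ) : U := fgen (2 * a + 1)

/-- The segment `⟨2a+1, 2b+1⟩`. -/
def fseg (a b : ℤ) : U := seg (2 * a + 1) (2 * b + 1)

theorem ff_eq_mk (a : ℤ) : ff a = RingQuot.mkAlgHom K BRel (g (.F a)) := by
  rw [ff, fgen, show (2 * a + 1 - 1) / 2 = a by omega]

theorem fseg_self (a : ℤ) : fseg a a = ff a := by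
  rw [fseg, seg, sub_self]; rfl

theorem fseg_succ {a b : ℤ} (h : a ≤ b) : fseg a (b + 1) = qbr (fseg a b) (ff (b + 1)) := by
  obtain ⟨n, rfl⟩ := Int.le.dest h
  rw [fseg, fseg, seg, seg, show ((2 * (a + n + 1) + 1 - (2 * a + 1)) / 2).toNat = n + 1 by omega,
    show ((2 * (a + n) + 1 - (2 * a + 1)) / 2).toNat = n by omega, segAux, qbr, ff,
    show 2 * a + 1 + 2 * ((n : ℤ) + 1) = 2 * (a + n + 1) + 1 by ring]

theorem ff_far {a b : ℤ} (h : 1 < |a - b|) : QComm 0 (ff a) (ff b) := by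
  have := RingQuot.mkAlgHom_rel K (BRel.Ffar a b h)
  simpa [QComm, ff_eq_mk] using this

theorem ff_serre {a b : ℤ} (h : |a - b| = 1) :
    ff a * ff a * ff b + ff b * (ff a * ff a) = (q + q⁻¹) • (ff a * ff b * ff a) := by
  have := RingQuot.mkAlgHom_rel K (BRel.Fserre a b h)
  simpa only [ff_eq_mk, map_add, map_mul, map_smul] using this

theorem ff_qcomm_qbr (a : ℤ) : QComm (-1) (ff a) (qbr (ff a) (ff (a + 1))) :=
  qcomm_left_qbr (ff_serre (by norm_num))

theorem qbr_qcomm_ff (a : ℤ) : QComm (-1) (qbr (ff a) (ff (a + 1))) (ff (a + 1)) :=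
  qcomm_qbr_right (ff_serre (by norm_num))

/-- If `x` commutes up to powers of `q` with the letters of a segment, it does so with the
segment. -/
theorem qcomm_fseg {x : U} {a b d : ℤ} (hab : a ≤ b) (ha : QComm d x (ff a))
    (h : ∀ c, a < c → c ≤ b → QComm 0 x (ff c)) : QComm d x (fseg a b) := by
  induction b, hab using Int.leInduction with
  | base => rwa [fseg_self]
  | succ b hab ih =>
    rw [fseg_succ hab]
    exact ((ih fun c h1 h2 => h c h1 (by omega)).qbr_right (h _ (by omega) le_rfl)).congr (by ring)

theorem qcomm_fseg_zero {x : U} {a b : ℤ} (hab : a ≤ b)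
    (h : ∀ c, a ≤ c → c ≤ b → QComm 0 x (ff c)) : QComm 0 x (fseg a b) :=
  qcomm_fseg hab (h a le_rfl hab) fun c h1 h2 => h c h1.le h2

theorem ff_fseg_far {a b c : ℤ} (hab : a ≤ b) (h : c < a - 1 ∨ b + 1 < c) :
    QComm 0 (ff c) (fseg a b) :=
  qcomm_fseg_zero hab fun d h1 h2 => ff_far (by rw [lt_abs]; omega)

theorem fseg_concat {a b c : ℤ} (hac : a ≤ c) (hcb : c < b) :
    fseg a b = qbr (fseg a c) (fseg (c + 1) b) := by
  obtain ⟨b, rfl⟩ : ∃ b', b = b' + 1 := ⟨b - 1, by ring⟩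
  have hcb' : c ≤ b := by omega
  induction b, hcb' using Int.leInduction with
  | base => rw [fseg_succ hac, fseg_self]
  | succ b hab ih =>
    rw [fseg_succ (a := a) (b := b + 1) (by omega), ih (by omega),
      fseg_succ (a := c + 1) (b := b + 1) (by omega), qbr_assoc]
    exact (ff_fseg_far (c := b + 1 + 1) hac (by omega)).symm.congr neg_zero

theorem fseg_head {a b : ℤ} (h : a < b) : fseg a b = qbr (ff a) (fseg (a + 1) b) := by
  rw [fseg_concat le_rfl h, fseg_self]

/-- A generator at an interior vertex commutes with a segment. -/
theorem ff_fseg_interior {a b c : ℤ} (hac : a < c) (hcb : c < b) :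
    QComm 0 (ff c) (fseg a b) := by
  obtain ⟨b, rfl⟩ : ∃ b', b = b' + 1 := ⟨b - 1, by ring⟩
  have hcb' : c ≤ b := by omega
  induction b, hcb' using Int.leInduction with
  | base =>
    obtain ⟨n, hn⟩ := Int.le.dest (show a ≤ c - 1 by omega)
    clear hcb
    induction n generalizing a with
    | zero =>
      obtain rfl : c = a + 1 := by simp at hn; omega
      rw [fseg_succ hac.le, fseg_succ le_rfl, fseg_self]
      exact qcomm_middle (ff_far (by rw [lt_abs]; omega)) (qbr_qcomm_ff a) (ff_qcomm_qbr _)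
    | succ n ih =>
      push_cast at hn
      rw [fseg_head (by omega)]
      exact ((ff_far (by rw [lt_abs]; omega)).qbr_right
        (ih (a := a + 1) (by omega) (by omega))).congr (by ring)
  | succ b hab ih =>
    rw [fseg_succ (by omega)]
    exact ((ih (by omega)).qbr_right (ff_far (by rw [lt_abs]; omega))).congr (by ring)

theorem fseg_interior {a b c d : ℤ} (hac : a < c) (hcd : c ≤ d) (hdb : d < b) :
    QComm 0 (fseg c d) (fseg a b) :=
  ((qcomm_fseg_zero hcd fun e h1 h2 =>
    (ff_fseg_interior (by omega) (by omega)).symm.congr neg_zero).symm).congr neg_zero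

theorem fseg_ff_last {a b : ℤ} (h : a < b) : QComm (-1) (fseg a b) (ff b) := by
  obtain ⟨b, rfl⟩ : ∃ b', b = b' + 1 := ⟨b - 1, by ring⟩
  obtain ⟨n, hn⟩ := Int.le.dest (show a ≤ b by omega)
  induction n generalizing a with
  | zero =>
    obtain rfl : a = b := by simpa using hn
    rw [fseg_succ le_rfl, fseg_self]
    exact qbr_qcomm_ff a
  | succ n ih =>
    push_cast at hn
    rw [fseg_head (by omega)]
    exact ((ff_far (by rw [lt_abs]; omega)).qbr_left (ih (a := a + 1) (by omega) (by omega))).congr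
      (by ring)

theorem ff_first_fseg {a b : ℤ} (h : a < b) : QComm (-1) (ff a) (fseg a b) := by
  obtain ⟨b, rfl⟩ : ∃ b', b = b' + 1 := ⟨b - 1, by ring⟩
  have hab : a ≤ b := by omega
  induction b, hab using Int.leInduction with
  | base =>
    rw [fseg_succ le_rfl, fseg_self]
    exact ff_qcomm_qbr a
  | succ b hab ih =>
    rw [fseg_succ (by omega)]
    exact ((ih (by omega)).qbr_right (ff_far (by rw [lt_abs]; omega))).congr (by ring)

theorem fseg_same_last {a a' b : ℤ} (h : a < a') (h' : a' ≤ b) :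
    QComm (-1) (fseg a b) (fseg a' b) := by
  rcases h'.lt_or_eq with h' | rfl
  · obtain ⟨b, rfl⟩ : ∃ b', b = b' + 1 := ⟨b - 1, by ring⟩
    rw [fseg_succ (a := a') (by omega)]
    exact (((fseg_interior h (by omega) (by omega)).symm).qbr_right
      (fseg_ff_last (by omega))).congr (by ring)
  · rw [fseg_self]
    exact fseg_ff_last h

theorem fseg_same_first {a b : ℤ} (h : a ≤ b) :
    QComm (-1) (fseg a b) (fseg a (b + 1)) := by
  rcases h.lt_or_eq with h | rfl
  · rw [fseg_head h]
    exact ((ff_first_fseg (by omega)).qbr_left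
      (fseg_interior (by omega) (by omega) (by omega))).congr (by ring)
  · rw [fseg_self]
    exact ff_first_fseg (by omega)

end Segments

section Relations

attribute [local instance] algebraNatK algebraIntK

/-- The generator `E_{-(2n+1)}`. -/
def eE (n : ℤ) : U := Ee (-(2 * n + 1))

/-- The generator `T_{-(2n+1)}`. -/
def tT (n : ℤ) : U := Tt (-(2 * n + 1))

theorem eE_eq_mk (n : ℤ) : eE n = RingQuot.mkAlgHom K BRel (g (.E (-n - 1))) := by
  rw [eE, Ee, show (-(2 * n + 1) - 1) / 2 = -n - 1 by omega]

theorem tT_eq_mk (n : ℤ) : tT n = RingQuot.mkAlgHom K BRel (g (.T (-n - 1))) := by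
  rw [tT, Tt, show (-(2 * n + 1) - 1) / 2 = -n - 1 by omega]

theorem eE_mul_ff (n b : ℤ) :
    eE n * ff b = q ^ (-ip (2 * (-n - 1) + 1) (2 * b + 1)) • (ff b * eE n)
      + (if -n - 1 = b then 1 else 0) + (if n = b then tT n else 0) := by
  have := RingQuot.mkAlgHom_rel K (BRel.EF (-n - 1) b)
  rw [show -(-n - 1) - 1 = n by ring] at this
  simp only [map_add, map_mul, map_smul, ← eE_eq_mk, ← ff_eq_mk, apply_ite (RingQuot.mkAlgHom K BRel), map_one, map_zero,
    ← tT_eq_mk] at this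
  exact this

theorem eE_ff_qcomm {n b : ℤ} (h1 : b ≠ -n - 1) (h2 : b ≠ n) :
    QComm (-ip (2 * (-n - 1) + 1) (2 * b + 1)) (eE n) (ff b) := by
  rw [QComm, eE_mul_ff, if_neg h1.symm, if_neg h2.symm, add_zero, add_zero]

theorem eE_ff_far {n b : ℤ} (h1 : b ≠ -n - 1) (h2 : b ≠ n) (h3 : b ≠ -n) (h4 : b ≠ -n - 2) :
    QComm 0 (eE n) (ff b) :=
  (eE_ff_qcomm h1 h2).congr (by unfold ip; split_ifs <;> omega)

theorem eE_ff_near {n b : ℤ} (h2 : b ≠ n) (h3 : b = -n ∨ b = -n - 2) :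
    QComm 1 (eE n) (ff b) :=
  (eE_ff_qcomm (by omega) h2).congr (by unfold ip; split_ifs <;> omega)

theorem eE_mul_ff_neg (n : ℤ) :
    eE n * ff (-n - 1) = q ^ (-2 : ℤ) • (ff (-n - 1) * eE n) + 1 := by
  rw [eE_mul_ff, if_pos rfl, if_neg (by omega), add_zero]
  simp [ip]

theorem eE_mul_ff_pos {n : ℤ} (hn : 0 < n) : eE n * ff n = ff n * eE n + tT n := by
  rw [eE_mul_ff, if_neg (by omega), if_pos rfl, add_zero,
    show -ip (2 * (-n - 1) + 1) (2 * n + 1) = 0 by unfold ip; split_ifs <;> omega, zpow_zero,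
    one_smul]

theorem eE_mul_ff_zero : eE 0 * ff 0 = q ^ (1 : ℤ) • (ff 0 * eE 0) + tT 0 := by
  rw [eE_mul_ff, if_neg (by omega), if_pos rfl, add_zero,
    show -ip (2 * (-0 - 1) + 1) (2 * 0 + 1) = 1 by unfold ip; split_ifs <;> omega]

theorem tT_ff (n b : ℤ) :
    QComm (-(ip (2 * (-n - 1) + 1) (2 * b + 1) + ip (-(2 * (-n - 1) + 1)) (2 * b + 1)))
      (tT n) (ff b) := by
  have h1 := RingQuot.mkAlgHom_rel K (BRel.TF (-n - 1) b)
  have h2 := RingQuot.mkAlgHom_rel K (BRel.TinvT (-n - 1))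
  simp only [map_mul, map_smul, ← tT_eq_mk, ← ff_eq_mk, map_one] at h1 h2
  have h3 := congrArg (fun x => x * tT n) h1
  simp only [mul_assoc, h2, mul_one, smul_mul_assoc] at h3
  exact h3

/-- The pairing of the simple root `α_{2j+1}` with the weight of the segment `⟨2a+1,2b+1⟩`. -/
def cform (j a b : ℤ) : ℤ :=
  (if j = a then 1 else 0) + (if j = b then 1 else 0) - (if j = a - 1 then 1 else 0)
    - (if j = b + 1 then 1 else 0)

theorem tT_fseg (n : ℤ) {a b : ℤ} (hab : a ≤ b) :
    QComm (-(cform (-n - 1) a b + cform n a b)) (tT n) (fseg a b) := by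
  have key : ∀ b, -(ip (2 * (-n - 1) + 1) (2 * b + 1) + ip (-(2 * (-n - 1) + 1)) (2 * b + 1)) =
      -(cform (-n - 1) b b + cform n b b) := by
    intro b
    have : ∀ j, ip (2 * j + 1) (2 * b + 1) = cform j b b := by
      intro j; unfold ip cform; split_ifs <;> omega
    rw [this, show -(2 * (-n - 1) + 1) = 2 * n + 1 by ring, this]
  induction b, hab using Int.leInduction with
  | base => rw [fseg_self]; exact (tT_ff n a).congr (key a)
  | succ b hab ih =>
    rw [fseg_succ hab]
    refine (ih.qbr_right ((tT_ff n (b + 1)).congr (key _))).congr ?_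
    have h : ∀ j, cform j a b + cform j (b + 1) (b + 1) = cform j a (b + 1) := by
      intro j; unfold cform; split_ifs <;> omega
    rw [← h, ← h]
    ring

theorem tT_fseg_of {n a b e : ℤ} (hab : a ≤ b) (h : -(cform (-n - 1) a b + cform n a b) = e) :
    QComm e (tT n) (fseg a b) :=
  (tT_fseg n hab).congr h

section Abstract

variable {A : Type*} [Ring A] [Algebra K A]

theorem E_mul_qbr_of_T {c : ℤ} {E T w f : A} (hw : QComm c E w) (hf : E * f = f * E + T)
    (hT : QComm (1 + c) T w) :
    E * qbr w f = q ^ c • (qbr w f * E + (1 - q ^ 2) • (w * T)) := by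
  have hq := q_ne_zero
  simp only [QComm, zpow_add₀ hq, zpow_one] at hw hT
  have h1 : E * (w * f) = q ^ c • (w * f * E + w * T) := by
    rw [← mul_assoc, hw, smul_mul_assoc, mul_assoc, hf, mul_add, mul_assoc]
  have h2 : E * (f * w) = q ^ c • (f * w * E + q • (w * T)) := by
    rw [← mul_assoc, hf, add_mul, mul_assoc, hw, hT, mul_smul_comm, mul_assoc]
    module
  simp only [qbr, mul_sub, mul_smul_comm, h1, h2, sub_mul, smul_mul_assoc]
  module

theorem E_mul_qbr_of_z {c : ℤ} {E T s z f : A} (hs : E * s = q ^ c • (s * E + z * T))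
    (hf : QComm 0 E f) (hT : QComm 1 T f) (hz : QComm 0 z f) :
    QComm c E (qbr s f) := by
  simp only [QComm, zpow_one, zpow_zero, one_smul] at *
  have h1 : E * (s * f) = q ^ c • (s * f * E + q • (z * f * T)) := by
    rw [← mul_assoc, hs, smul_mul_assoc, add_mul, mul_assoc, hf, mul_assoc, mul_assoc, hT,
      mul_smul_comm, mul_assoc]
  have h2 : E * (f * s) = q ^ c • (f * s * E + z * f * T) := by
    rw [← mul_assoc, hf, mul_assoc, hs, mul_smul_comm, mul_add, ← mul_assoc, ← mul_assoc f z, hz,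
      mul_assoc, mul_assoc]
  simp only [qbr, mul_sub, mul_smul_comm, h1, h2, sub_mul, smul_mul_assoc]
  module

end Abstract

theorem eE_fseg_inner {n a b : ℤ} (ha : -n < a) (hab : a ≤ b) (hb : b < n) :
    QComm 0 (eE n) (fseg a b) :=
  qcomm_fseg_zero hab fun c h1 h2 => eE_ff_far (by omega) (by omega) (by omega) (by omega)

theorem eE_fseg_edge {n b : ℤ} (hab : -n ≤ b) (hb : b < n) : QComm 1 (eE n) (fseg (-n) b) :=
  qcomm_fseg hab (eE_ff_near (by omega) (by omega))
    fun c h1 h2 => eE_ff_far (by omega) (by omega) (by omega) (by omega)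

/-- The action of `E_{-k}` on `⟨i,k⟩` for `-k+2 < i < k`. -/
theorem eE_fseg_mid {n a : ℤ} (ha : -n < a) (han : a < n) :
    eE n * fseg a n = fseg a n * eE n + (1 - q ^ 2) • (fseg a (n - 1) * tT n) := by
  obtain ⟨n, rfl⟩ : ∃ n', n = n' + 1 := ⟨n - 1, by ring⟩
  rw [fseg_succ (by omega), add_sub_cancel_right]
  have := E_mul_qbr_of_T (c := 0) (eE_fseg_inner (n := n + 1) (a := a) (b := n) ha (by omega)
    (by omega)) (eE_mul_ff_pos (by omega)) (tT_fseg_of (by omega)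
      (by unfold cform; split_ifs <;> omega))
  rwa [zpow_zero, one_smul] at this

/-- The action of `E_{-k}` on `⟨-k+2,k⟩`. -/
theorem eE_fseg_left {n : ℤ} (hn : 0 < n) :
    eE n * fseg (-n) n =
      q ^ (1 : ℤ) • (fseg (-n) n * eE n + (1 - q ^ 2) • (fseg (-n) (n - 1) * tT n)) := by
  obtain ⟨n, rfl⟩ : ∃ n', n = n' + 1 := ⟨n - 1, by ring⟩
  rw [fseg_succ (by omega), add_sub_cancel_right]
  exact E_mul_qbr_of_T (eE_fseg_edge (n := n + 1) (b := n) (by omega) (by omega))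
    (eE_mul_ff_pos (by omega)) (tT_fseg_of (by omega) (by unfold cform; split_ifs <;> omega))

theorem eE_fseg_outer_mid {n a b : ℤ} (hn : 0 ≤ n) (ha : -n < a) (hab : a ≤ b) (hb : n < b) :
    QComm 0 (eE n) (fseg a b) := by
  rcases lt_trichotomy a n with han | rfl | han
  · obtain ⟨b, rfl⟩ : ∃ n', b = n' + 1 := ⟨b - 1, by ring⟩
    have hb' : n ≤ b := by omega
    induction b, hb' using Int.leInduction with
    | base =>
      rw [fseg_succ han.le]
      refine E_mul_qbr_of_z (c := 0) (T := tT n) (z := (1 - q ^ 2) • fseg a (n - 1)) ?_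
        (eE_ff_far (by omega) (by omega) (by omega) (by omega)) ?_ ?_
      · rw [eE_fseg_mid ha han, zpow_zero, one_smul, smul_mul_assoc]
      · rw [← fseg_self]
        exact tT_fseg_of le_rfl (by unfold cform; split_ifs <;> omega)
      · exact ((ff_fseg_far (by omega) (by omega)).smul_right _).symm.congr neg_zero
    | succ b hb ih =>
      rw [fseg_succ (by omega)]
      exact ((ih (by omega) (by omega)).qbr_right
        (eE_ff_far (by omega) (by omega) (by omega) (by omega))).congr (by ring)
  · obtain ⟨b, rfl⟩ : ∃ n', b = n' + 1 := ⟨b - 1, by ring⟩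
    have hb' : a ≤ b := by omega
    induction b, hb' using Int.leInduction with
    | base =>
      rw [fseg_succ le_rfl, fseg_self]
      refine E_mul_qbr_of_z (c := 0) (T := tT a) (z := 1) ?_
        (eE_ff_far (by omega) (by omega) (by omega) (by omega)) ?_ (QComm.one_left _)
      · rw [eE_mul_ff_pos (by omega), zpow_zero, one_smul, one_mul]
      · rw [← fseg_self]
        exact tT_fseg_of le_rfl (by unfold cform; split_ifs <;> omega)
    | succ b hb ih =>
      rw [fseg_succ (by omega)]
      exact ((ih (by omega) (by omega)).qbr_right
        (eE_ff_far (by omega) (by omega) (by omega) (by omega))).congr (by ring)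
  · exact qcomm_fseg_zero hab fun c h1 h2 =>
      eE_ff_far (by omega) (by omega) (by omega) (by omega)

theorem eE_fseg_outer_left {n b : ℤ} (hn : 0 ≤ n) (hb : n < b) :
    QComm 1 (eE n) (fseg (-n) b) := by
  obtain ⟨b, rfl⟩ : ∃ n', b = n' + 1 := ⟨b - 1, by ring⟩
  have hb' : n ≤ b := by omega
  induction b, hb' using Int.leInduction with
  | base =>
    rw [fseg_succ (by omega)]
    rcases hn.lt_or_eq with hn | rfl
    · refine E_mul_qbr_of_z (c := 1) (T := tT n) (z := (1 - q ^ 2) • fseg (-n) (n - 1)) ?_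
        (eE_ff_far (by omega) (by omega) (by omega) (by omega)) ?_ ?_
      · rw [eE_fseg_left hn, smul_mul_assoc]
      · rw [← fseg_self]
        exact tT_fseg_of le_rfl (by unfold cform; split_ifs <;> omega)
      · exact ((ff_fseg_far (by omega) (by omega)).smul_right _).symm.congr neg_zero
    · rw [neg_zero, fseg_self]
      refine E_mul_qbr_of_z (c := 1) (T := tT 0) (z := q⁻¹ • 1) ?_
        (eE_ff_far (by omega) (by omega) (by omega) (by omega)) ?_ ?_
      · rw [eE_mul_ff_zero, smul_add, smul_mul_assoc, smul_smul, zpow_one,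
          mul_inv_cancel₀ q_ne_zero, one_smul, one_mul]
      · rw [← fseg_self]
        exact tT_fseg_of le_rfl (by unfold cform; split_ifs <;> omega)
      · exact (((QComm.one_left _).symm.congr neg_zero).smul_right _).symm.congr neg_zero
  | succ b hb ih =>
    rw [fseg_succ (by omega)]
    exact ((ih (by omega)).qbr_right
      (eE_ff_far (by omega) (by omega) (by omega) (by omega))).congr (by ring)

end Relations

section Vacuum

attribute [local instance] algebraNatK algebraIntK

section Abstract

variable {V : Type*} [AddCommGroup V] [Module K V]

theorem vacuum_base {f g F G : V →ₗ[K] V} {u : V} (hfg : f u = g u) (hFG : F u = G u)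
    (c1 : ∀ v, F (g v) = g (F v)) (c2 : ∀ v, G (f v) = f (G v))
    (hs : ∀ v, F (f (f v)) = (q + q⁻¹) • f (F (f v)) - f (f (F v)))
    (hs' : ∀ v, G (g (g v)) = (q + q⁻¹) • g (G (g v)) - g (g (G v))) :
    (q + q⁻¹) • (g (f (F u)) - q • f (g (F u))) =
      F (g (f u) - q • f (g u)) + G (g (f u) - q • f (g u)) := by
  have l1 : g (f (F u)) = g (G (g u)) := by rw [hFG, ← c2, hfg]
  have l2 : f (g (F u)) = f (F (f u)) := by rw [← c1, hfg]
  have l3 : g (f u) = g (g u) := by rw [hfg]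
  have l4 : f (g u) = f (f u) := by rw [hfg]
  have l5 : F (g (g u)) = g (g (G u)) := by rw [c1, c1, hFG]
  have l6 : G (f (f u)) = f (f (F u)) := by rw [c2, c2, hFG]
  simp only [l1, l2, l3, l4, map_sub, map_smul, hs, hs', l5, l6]
  module

theorem vacuum_step {f g F G N : V →ₗ[K] V} {u : V} (hfg : f u = g u) (hFG : F u = G u)
    (c1 : ∀ v, F (g v) = g (F v)) (c2 : ∀ v, G (f v) = f (G v)) (c3 : ∀ v, g (f v) = f (g v))
    (c4 : ∀ v, F (N v) = N (F v)) (c5 : ∀ v, G (N v) = N (G v))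
    (hs : ∀ v, F (f (f v)) = (q + q⁻¹) • f (F (f v)) - f (f (F v)))
    (hs' : ∀ v, G (g (g v)) = (q + q⁻¹) • g (G (g v)) - g (g (G v)))
    (hN : ∀ v, N (f (f v)) = (q + q⁻¹) • f (N (f v)) - f (f (N v)))
    (ih : (q + q⁻¹) • N (f u) = f (N u) + g (N u))
    {M : V →ₗ[K] V}
    (l : ∀ v, M v = g (N (f v)) - q • g (f (N v)) - q • N (f (g v)) + q ^ 2 • f (N (g v))) :
    (q + q⁻¹) • M (F u) = F (M u) + G (M u) := by
  have hq := q_ne_zero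
  have hqq : q + q⁻¹ ≠ 0 := by
    intro h
    apply one_add_q_sq_ne_zero
    have := congrArg (q * ·) h
    simp only [mul_add, mul_inv_cancel₀ hq, mul_zero] at this
    linear_combination this
  obtain ⟨κ, hκ⟩ : ∃ κ, κ * (q + q⁻¹) = 1 := ⟨(q + q⁻¹)⁻¹, inv_mul_cancel₀ hqq⟩
  have hκ' : κ * (q ^ 2 + 1) = q := by
    have := congrArg (· * q) hκ
    simp only [mul_assoc, add_mul, inv_mul_cancel₀ hq, one_mul] at this
    linear_combination this
  obtain ⟨ν, hν⟩ : ∃ ν, ν = N u := ⟨_, rfl⟩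
  have hFν : F ν = G ν := by rw [hν, c4, c5, hFG]
  have cancel : ∀ {v w : V}, (q + q⁻¹) • v = w → v = κ • w := by
    rintro v w rfl
    rw [smul_smul, hκ, one_smul]
  have b1 : N (f u) = κ • (f ν + g ν) := by
    rw [hν]
    exact cancel ih
  have b2 : N (f (f u)) = f (g ν) := by
    rw [hN, b1, map_smul, map_add, smul_smul, mul_comm _ κ, hκ, one_smul, ← hν,
      add_sub_cancel_left]
  have r1 : M u = κ • (g (g ν) - (q ^ 2 + 1) • f (g ν) + q ^ 2 • f (f ν)) := by
    rw [l, ← hfg, b2, b1, ← hν]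
    simp only [map_smul, map_add, c3]
    linear_combination (norm := module) (2 * hκ') • f (g ν)
  have n1 : N (f (F u)) = κ • (f (G ν) + G (g ν)) := by
    rw [hFG, ← c2, ← c5, b1, map_smul, map_add, c2]
  have n2 : N (f (F (f u))) = κ • (f (G (g ν)) + g (F (f ν))) := by
    have h' : f (F (f u)) = κ • (F (f (f u)) + f (f (F u))) :=
      cancel (by rw [hs, sub_add_cancel])
    rw [h', map_smul, map_add, ← c4, b2, hFG, ← c2, ← c2, ← c5, b2, c2, ← c3, c1, add_comm]
  have n3 : N (F (g u)) = κ • (F (f ν) + g (F ν)) := by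
    rw [← c4, ← hfg, b1, map_smul, map_add, c1]
  have r2 : M (F u) = κ • g (G (g ν)) + (q ^ 2 * κ) • f (F (f ν))
      - (q * κ) • (f (G (g ν)) + g (F (f ν))) := by
    rw [l, n1, ← c1, n3, ← c4, ← hfg, n2, ← hν, hFν]
    simp only [map_smul, map_add, c3]
    linear_combination (norm := module) hκ' • f (g (G ν))
  have s1 : F (g (g ν)) = g (g (G ν)) := by rw [c1, c1, hFν]
  have s2 : G (f (f ν)) = f (f (F ν)) := by rw [c2, c2, hFν]
  have s3 : F (f (g ν)) = g (F (f ν)) := by rw [← c3, c1]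
  rw [r1, r2]
  simp only [map_add, map_sub, map_smul, hs, hs', s1, s2, s3, c2]
  linear_combination (norm := module) (-κ * mul_inv_cancel₀ hq) • (f (G (g ν)) + g (F (f ν)))

end Abstract

section Action

variable {A V : Type*} [Ring A] [Algebra K A] [AddCommGroup V] [Module K V] [Module A V]
  [IsScalarTower K A V]

theorem smul_smul_of_serre {x y : A} (h : x * x * y + y * (x * x) = (q + q⁻¹) • (x * y * x))
    (v : V) : y • x • x • v = (q + q⁻¹) • x • y • x • v - x • x • y • v := by
  have := congrArg (· • v) h
  simp only [add_smul, mul_smul, smul_assoc] at this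
  rw [add_smul, ← this, add_sub_cancel_left]

omit [Module K V] [IsScalarTower K A V] in
theorem smul_smul_of_comm {x y : A} (h : QComm 0 x y) (v : V) : x • y • v = y • x • v := by
  rw [smul_smul, h.eq, mul_smul]

theorem qbr_smul (x y : A) (v : V) : qbr x y • v = x • y • v - q • y • x • v := by
  rw [qbr, sub_smul, smul_assoc, mul_smul, mul_smul]

theorem smul_smul_of_qbr {x y : A} (h : QComm (-1) (qbr x y) y) (v : V) :
    x • y • y • v = (q + q⁻¹) • y • x • y • v - y • y • x • v := by
  have hq := q_ne_zero
  have h' : qbr x y • y • v = q⁻¹ • y • qbr x y • v := by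
    rw [smul_smul, h, zpow_neg_one, smul_assoc, mul_smul]
  rw [qbr_smul, qbr_smul, smul_sub, smul_comm y q, smul_sub,
    smul_smul q⁻¹ q, inv_mul_cancel₀ hq, one_smul] at h'
  generalize x • y • y • v = a at *
  generalize y • x • y • v = b at *
  generalize y • y • x • v = c at *
  linear_combination (norm := module) h'

theorem qbr_qbr_smul (x y z : A) (v : V) : qbr z (qbr x y) • v =
    z • x • y • v - q • z • y • x • v - q • x • y • z • v + q ^ 2 • y • x • z • v := by
  simp only [qbr_smul, smul_sub, smul_comm z q]
  generalize z • x • y • v = a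
  generalize z • y • x • v = b
  generalize x • y • z • v = c
  generalize y • x • z • v = d
  module

theorem vacuum_reflect {M F G : A} {u : V} (hFG : F • u = G • u)
    (h : (q + q⁻¹) • M • F • u = F • M • u + G • M • u) :
    qbr G M • u = q ^ (-1 : ℤ) • qbr M F • u := by
  have hq := q_ne_zero
  rw [zpow_neg_one, qbr_smul, qbr_smul, ← hFG]
  generalize F • M • u = x at *
  generalize G • M • u = y at *
  generalize M • F • u = z at *
  simp only [smul_sub, smul_smul, inv_mul_cancel₀ hq, one_smul]
  linear_combination (norm := module) (-1 : K) • h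

end Action

/-- The element `f_{2a+1}` as an operator on `Ṽ_θ(0)`. -/
theorem ff_smul_phi (a : ℤ) : ff a • phi = ff (-a - 1) • phi := by
  have h : ff a - ff (-a - 1) ∈ Jideal := Ideal.subset_span
    ⟨2 * a + 1, ⟨a, rfl⟩, Or.inr (Or.inr (by
      rw [ff, ff, show 2 * (-a - 1) + 1 = -(2 * a + 1) by ring]))⟩
  have := (Submodule.Quotient.mk_eq_zero Jideal).mpr h
  refine sub_eq_zero.mp ((sub_smul (ff a) (ff (-a - 1)) phi).symm.trans ?_)
  rw [phi, ← Submodule.Quotient.mk_smul, smul_eq_mul, mul_one]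
  exact this

theorem eE_smul_phi (n : ℤ) : eE n • phi = 0 := by
  have h : eE n ∈ Jideal := Ideal.subset_span
    ⟨-(2 * n + 1), ⟨-n - 1, by ring⟩, Or.inl rfl⟩
  have := (Submodule.Quotient.mk_eq_zero Jideal).mpr h
  rw [phi, ← Submodule.Quotient.mk_smul, smul_eq_mul, mul_one]
  exact this

theorem tT_smul_phi (n : ℤ) : tT n • phi = phi := by
  have h : tT n - 1 ∈ Jideal := Ideal.subset_span
    ⟨-(2 * n + 1), ⟨-n - 1, by ring⟩, Or.inr (Or.inl rfl)⟩
  have := (Submodule.Quotient.mk_eq_zero Jideal).mpr h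
  refine sub_eq_zero.mp (Eq.trans ?_ ((sub_smul (tT n) 1 phi).symm.trans ?_))
  · rw [one_smul]
  · rw [phi, ← Submodule.Quotient.mk_smul, smul_eq_mul, mul_one]
    exact this

theorem fseg_vacuum {n : ℕ} (hn : 0 < n) :
    (q + q⁻¹) • fseg (-n) (n - 1) • ff n • phi =
      ff n • fseg (-n) (n - 1) • phi + ff (-n - 1) • fseg (-n) (n - 1) • phi := by
  induction n with
  | zero => omega
  | succ n ih =>
    have hs : ∀ v : Vt, ff (n + 1) • ff n • ff n • v =
        (q + q⁻¹) • ff n • ff (n + 1) • ff n • v - ff n • ff n • ff (n + 1) • v :=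
      smul_smul_of_serre (V := Vt) (ff_serre (a := n) (b := n + 1) (by rw [abs_eq] <;> omega))
    have hs' : ∀ v : Vt, ff (-n - 2) • ff (-n - 1) • ff (-n - 1) • v =
        (q + q⁻¹) • ff (-n - 1) • ff (-n - 2) • ff (-n - 1) • v
          - ff (-n - 1) • ff (-n - 1) • ff (-n - 2) • v :=
      smul_smul_of_serre (V := Vt) (ff_serre (a := -n - 1) (b := -n - 2) (by rw [abs_eq] <;> omega))
    have hfg : ff n • phi = ff (-n - 1) • phi := ff_smul_phi _
    have hFG : ff (n + 1) • phi = ff (-n - 2) • phi := by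
      rw [ff_smul_phi]; congr 2; ring
    have far : ∀ {a b : ℤ}, (a - b < -1 ∨ 1 < a - b) → ∀ v : Vt,
        ff a • ff b • v = ff b • ff a • v := fun {a b} h v =>
      smul_smul_of_comm (V := Vt) (ff_far (a := a) (b := b) (by rw [lt_abs]; omega)) v
    have far' : ∀ {a b c : ℤ}, a ≤ b → (c < a - 1 ∨ b + 1 < c) → ∀ v : Vt,
        ff c • fseg a b • v = fseg a b • ff c • v := fun hab h v =>
      smul_smul_of_comm (V := Vt) (ff_fseg_far hab h) v
    push_cast
    rw [show -((n : ℤ) + 1) = -n - 1 by ring, add_sub_cancel_right,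
      show (-n - 1 - 1 : ℤ) = -n - 2 by ring]
    rcases Nat.eq_zero_or_pos n with rfl | hn
    · have := vacuum_base (f := Algebra.lsmul K K Vt (ff (0 : ℕ)))
        (g := Algebra.lsmul K K Vt (ff (-(0 : ℕ) - 1)))
        (F := Algebra.lsmul K K Vt (ff ((0 : ℕ) + 1)))
        (G := Algebra.lsmul K K Vt (ff (-(0 : ℕ) - 2))) hfg hFG
        (far (by simp)) (far (by simp)) hs hs'
      simp only [Algebra.lsmul_coe] at this
      rw [fseg_head (by simp), show (-((0 : ℕ) : ℤ) - 1 + 1) = (0 : ℕ) by simp, fseg_self]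
      simpa only [qbr_smul] using this
    · have := vacuum_step (f := Algebra.lsmul K K Vt (ff n))
        (g := Algebra.lsmul K K Vt (ff (-n - 1)))
        (F := Algebra.lsmul K K Vt (ff (n + 1)))
        (G := Algebra.lsmul K K Vt (ff (-n - 2)))
        (N := Algebra.lsmul K K Vt (fseg (-n) (n - 1)))
        (M := Algebra.lsmul K K Vt (fseg (-n - 1) n)) hfg hFG
        (far (by omega)) (far (by omega)) (far (by omega))
        (far' (by omega) (by omega)) (far' (by omega) (by omega)) hs hs' ?_ (ih hn) ?_
      · exact this
      · exact smul_smul_of_qbr (V := Vt) (by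
          have h := fseg_ff_last (a := -n) (b := n) (by omega)
          rwa [show fseg (-n) n = qbr (fseg (-n) (n - 1)) (ff n) by
            simpa using fseg_succ (a := -n) (b := n - 1) (by omega)] at h)
      · intro v
        rw [fseg_head (by omega), show (-n - 1 + 1 : ℤ) = -n by ring,
          show fseg (-n) n = qbr (fseg (-n) (n - 1)) (ff n) by
            simpa using fseg_succ (a := -n) (b := n - 1) (by omega)]
        exact qbr_qbr_smul (V := Vt) _ _ _ v

/-- The segments `⟨-k,k-2⟩` and `⟨-k+2,k⟩` agree on the vacuum up to a power of `q`. -/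
theorem fseg_reflect {n : ℕ} (hn : 0 < n) :
    fseg (-n - 1) (n - 1) • phi = q ^ (-1 : ℤ) • fseg (-n) n • phi := by
  rw [fseg_head (a := -n - 1) (by omega), show (-n - 1 + 1 : ℤ) = -n by ring,
    show fseg (-n) n = qbr (fseg (-n) (n - 1)) (ff n) by
      simpa using fseg_succ (a := -n) (b := n - 1) (by omega)]
  exact vacuum_reflect (V := Vt) (ff_smul_phi _) (fseg_vacuum hn)

end Vacuum

section OuterRelations

attribute [local instance] algebraNatK algebraIntK

section Abstract

variable {A : Type*} [Ring A] [Algebra K A]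

theorem E_mul_qbr_of_head {E f x z : A} (hf : E * f = q ^ (-2 : ℤ) • (f * E) + 1)
    (hx : E * x = q ^ (1 : ℤ) • (x * E) + z) :
    E * qbr f x = q ^ (-1 : ℤ) • (qbr f x * E) + (1 - q ^ 2) • x
      + (q ^ (-2 : ℤ) • (f * z) - q • (z * f)) := by
  have hq := q_ne_zero
  have e1 : q ^ (-2 : ℤ) * q = q ^ (-1 : ℤ) := by rw [← zpow_add_one₀ hq]; rfl
  have e2 : q * q * q ^ (-2 : ℤ) = q ^ (-1 : ℤ) * q := by
    rw [mul_assoc, mul_comm q (q ^ (-2 : ℤ)), e1, mul_comm]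
  have h1 : E * (f * x) = q ^ (-1 : ℤ) • (f * x * E) + q ^ (-2 : ℤ) • (f * z) + x := by
    rw [← mul_assoc, hf, add_mul, one_mul, smul_mul_assoc, mul_assoc, hx, mul_add, smul_add,
      mul_smul_comm, smul_smul, zpow_one, e1, mul_assoc]
  have h2 : q • (E * (x * f)) = (q ^ (-1 : ℤ) * q) • (x * f * E) + q ^ 2 • x + q • (z * f) := by
    rw [← mul_assoc, hx, add_mul, smul_mul_assoc, mul_assoc, hf, mul_add, mul_smul_comm, smul_add,
      smul_add, smul_add, smul_smul, smul_smul, smul_smul, zpow_one, e2, mul_one, mul_assoc, sq]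
  rw [qbr, mul_sub, mul_smul_comm, h1, h2, sub_mul, smul_mul_assoc]
  module

theorem QComm_qbr_of_head {E f y x : A} (hf : QComm 1 E f)
    (hy : E * y = q ^ (-1 : ℤ) • (y * E) + (1 - q ^ 2) • x) (hx : QComm 0 f x) :
    QComm 0 E (qbr f y) := by
  have hq := q_ne_zero
  have h1 : E * (f * y) = f * y * E + (q * (1 - q ^ 2)) • (f * x) := by
    rw [← mul_assoc, hf, zpow_one, smul_mul_assoc, mul_assoc, hy, mul_add, smul_add,
      mul_smul_comm, mul_smul_comm, smul_smul, smul_smul, zpow_neg_one, mul_inv_cancel₀ hq,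
      one_smul, mul_assoc]
  have h2 : E * (y * f) = y * f * E + (1 - q ^ 2) • (f * x) := by
    rw [← mul_assoc, hy, add_mul, smul_mul_assoc, smul_mul_assoc, mul_assoc, hf, zpow_one,
      mul_smul_comm, smul_smul, zpow_neg_one, inv_mul_cancel₀ hq, one_smul, hx.eq, mul_assoc]
  rw [QComm, zpow_zero, one_smul, qbr, mul_sub, mul_smul_comm, h1, h2, sub_mul, smul_mul_assoc]
  module

end Abstract

/-- The action of `E_{-k}` on `⟨-k,l⟩` for `l > k`. -/
theorem eE_fseg_outer_neg {n b : ℤ} (hn : 0 ≤ n) (hb : n < b) :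
    eE n * fseg (-n - 1) b =
      q ^ (-1 : ℤ) • (fseg (-n - 1) b * eE n) + (1 - q ^ 2) • fseg (-n) b := by
  rw [fseg_head (a := -n - 1) (by omega), sub_add_cancel]
  have := E_mul_qbr_of_head (z := 0) (eE_mul_ff_neg n)
    (by rw [add_zero]; exact eE_fseg_outer_left hn hb)
  simpa only [mul_zero, zero_mul, smul_zero, sub_zero, add_zero] using this

theorem eE_fseg_far {n a b : ℤ} (hn : 0 ≤ n) (ha : a < -n - 1) (hb : n < b) :
    QComm 0 (eE n) (fseg a b) := by
  obtain ⟨t, ht⟩ := Int.le.dest (show a ≤ -n - 2 by omega)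
  induction t generalizing a with
  | zero =>
    obtain rfl : a = -n - 2 := by simpa using ht
    rw [fseg_head (by omega), show -n - 2 + 1 = -n - 1 by ring]
    exact QComm_qbr_of_head (eE_ff_near (by omega) (by omega)) (eE_fseg_outer_neg hn hb)
      (ff_fseg_far (by omega) (by omega))
  | succ t ih =>
    push_cast at ht
    rw [fseg_head (by omega)]
    exact ((eE_ff_far (by omega) (by omega) (by omega) (by omega)).qbr_right
      (ih (a := a + 1) (by omega) (by omega))).congr (by ring)

/-- The action of `E_{-k}` on `⟨-k,k⟩` for `k > 1`. -/
theorem eE_fseg_sym {n : ℤ} (hn : 0 < n) :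
    eE n * fseg (-n - 1) n = q ^ (-1 : ℤ) • (fseg (-n - 1) n * eE n) + (1 - q ^ 2) • fseg (-n) n
      + (q ^ (-1 : ℤ) * (1 - q ^ 2)) • (fseg (-n - 1) (n - 1) * tT n) := by
  have hq := q_ne_zero
  have hT : QComm (-2) (tT n) (ff (-n - 1)) := by
    rw [← fseg_self]
    exact tT_fseg_of le_rfl (by unfold cform; split_ifs <;> omega)
  have h := E_mul_qbr_of_head (z := (q * (1 - q ^ 2)) • (fseg (-n) (n - 1) * tT n))
    (eE_mul_ff_neg n)
    (by rw [eE_fseg_left hn, zpow_one, smul_add, smul_smul])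
  have e1 : q ^ (-2 : ℤ) * q = q ^ (-1 : ℤ) := by rw [← zpow_add_one₀ hq]; rfl
  rw [fseg_head (a := -n - 1) (b := n) (by omega),
    fseg_head (a := -n - 1) (b := n - 1) (by omega), sub_add_cancel, h]
  congr 1
  rw [smul_mul_assoc, mul_assoc, hT, mul_smul_comm, mul_smul_comm, smul_smul, smul_smul, smul_smul,
    qbr, sub_mul, smul_mul_assoc, smul_sub, smul_smul, mul_assoc, mul_assoc]
  rw [show q ^ (-2 : ℤ) * (q * (1 - q ^ 2)) = q ^ (-1 : ℤ) * (1 - q ^ 2) by rw [← mul_assoc, e1],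
    show q * (q * ((1 - q ^ 2) * q ^ (-2 : ℤ))) = q ^ (-1 : ℤ) * (1 - q ^ 2) * q by
      rw [← e1]; ring]
  simp only [mul_assoc]

/-- The action of `E_{-1}` on `⟨-1,1⟩`. -/
theorem eE_fseg_sym_zero :
    eE 0 * fseg (-1) 0 = q ^ (-1 : ℤ) • (fseg (-1) 0 * eE 0) + (1 - q ^ 2) • fseg 0 0
      + (q ^ (-1 : ℤ) * (1 - q ^ 2)) • ((q⁻¹ • ff (-1)) * tT 0) := by
  have hq := q_ne_zero
  have hT : QComm (-1) (tT 0) (ff (-1)) := by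
    rw [← fseg_self]
    exact tT_fseg_of le_rfl (by simp [cform])
  have h := E_mul_qbr_of_head (z := tT 0) (eE_mul_ff_neg 0) eE_mul_ff_zero
  rw [fseg_head (by omega), show (-1 + 1 : ℤ) = 0 by rfl, fseg_self]
  rw [show (-0 - 1 : ℤ) = -1 by rfl] at h
  rw [h, hT, smul_mul_assoc, smul_smul, smul_smul]
  congr 1
  refine (sub_smul (q ^ (-2 : ℤ)) (q * q ^ (-1 : ℤ)) (ff (-1) * tT 0)).symm.trans ?_
  congr 1
  rw [show (-2 : ℤ) = -1 + -1 by rfl, zpow_add₀ hq, zpow_neg_one]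
  field_simp

end OuterRelations

section Products

attribute [local instance] algebraNatK algebraIntK

/-- The modified divided power of the segment `⟨2a+1,2b+1⟩`. -/
def spow (a b e : ℤ) : U :=
  if a = -b - 1 then dpow qnumEven (fseg a b) e else dpow qnum (fseg a b) e

theorem spow_of_ne {a b : ℤ} (h : a ≠ -b - 1) (e : ℤ) : spow a b e = dpow qnum (fseg a b) e :=
  if_neg h

theorem spow_of_eq {a b : ℤ} (h : a = -b - 1) (e : ℤ) :
    spow a b e = dpow qnumEven (fseg a b) e :=
  if_pos h

theorem spow_of_neg (a b : ℤ) {e : ℤ} (h : e < 0) : spow a b e = 0 := by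
  unfold spow
  split_ifs <;> exact dpow_of_neg _ _ h

theorem segPowM_eq_spow (a b e : ℤ) : segPowM (2 * a + 1) (2 * b + 1) e = spow a b e := by
  unfold segPowM spow segPow dpow
  by_cases h : a = -b - 1
  · rw [if_pos (by omega), if_pos h]; rfl
  · rw [if_neg (by omega), if_neg h]; rfl

theorem spow_qcomm {x : U} {a b c e : ℤ} (h : QComm c x (fseg a b)) (he : 0 ≤ e) :
    QComm (c * e) x (spow a b e) := by
  unfold spow
  split_ifs <;> exact h.dpow_right _ he

theorem spow_qcomm_zero {x : U} {a b : ℤ} (h : QComm 0 x (fseg a b)) (e : ℤ) :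
    QComm 0 x (spow a b e) := by
  rcases lt_or_ge e 0 with he | he
  · rw [spow_of_neg a b he]; exact QComm.zero_right _ _
  · exact (spow_qcomm h he).congr (zero_mul _)

/-- The product of the modified divided powers along a list of segments, with exponents `e`. -/
def PL (L : List (ℤ × ℤ)) (e : ℤ → ℤ → ℤ) : U := (L.map fun p => spow p.1 p.2 (e p.1 p.2)).prod

theorem PL_nil (e : ℤ → ℤ → ℤ) : PL [] e = 1 := rfl

theorem PL_cons (p : ℤ × ℤ) (L : List (ℤ × ℤ)) (e : ℤ → ℤ → ℤ) :
    PL (p :: L) e = spow p.1 p.2 (e p.1 p.2) * PL L e := by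
  simp [PL]

theorem PL_append (L L' : List (ℤ × ℤ)) (e : ℤ → ℤ → ℤ) : PL (L ++ L') e = PL L e * PL L' e := by
  simp [PL]

theorem PL_congr {L : List (ℤ × ℤ)} {e e' : ℤ → ℤ → ℤ} (h : ∀ a b, (a, b) ∈ L → e a b = e' a b) :
    PL L e = PL L e' := by
  unfold PL
  congr 1
  exact List.map_congr_left fun p hp => by rw [h p.1 p.2 hp]

theorem PL_qcomm_zero {x : U} {L : List (ℤ × ℤ)} (h : ∀ a b, (a, b) ∈ L → QComm 0 x (fseg a b))
    (e : ℤ → ℤ → ℤ) : QComm 0 x (PL L e) := by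
  induction L with
  | nil => exact QComm.one_right x
  | cons p L ih =>
    rw [PL_cons]
    exact ((spow_qcomm_zero (h p.1 p.2 List.mem_cons_self) _).mul_right
      (ih fun a b hab => h a b (List.mem_cons_of_mem _ hab))).congr (by ring)

/-- The segments `⟨2a+1,2b+1⟩` with `lo ≤ a < lo + len`, in decreasing order. -/
def dl (lo b : ℤ) : ℕ → List (ℤ × ℤ)
  | 0 => []
  | len + 1 => (lo + len, b) :: dl lo b len

theorem mem_dl {lo b : ℤ} {len : ℕ} {x y : ℤ} :
    (x, y) ∈ dl lo b len ↔ y = b ∧ lo ≤ x ∧ x < lo + len := by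
  induction len with
  | zero => simp [dl]
  | succ len ih => simp only [dl, List.mem_cons, ih, Prod.mk.injEq]; push_cast; omega

theorem dl_add (lo b : ℤ) (x y : ℕ) : dl lo b (x + y) = dl (lo + y) b x ++ dl lo b y := by
  induction x with
  | zero => simp [dl]
  | succ x ih =>
    rw [show x + 1 + y = x + y + 1 by ring, dl, ih, dl, List.cons_append]
    congr 2
    push_cast; ring

theorem PL_dl_qcomm {x : U} {lo b c : ℤ} {len : ℕ} {e : ℤ → ℤ → ℤ}
    (h : ∀ a, lo ≤ a → a < lo + len → QComm c x (fseg a b))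
    (he : ∀ a, 0 ≤ e a b) :
    QComm (c * ∑ t ∈ Finset.range len, e (lo + t) b) x (PL (dl lo b len) e) := by
  induction len with
  | zero => exact (QComm.one_right x).congr (by simp)
  | succ len ih =>
    rw [dl, PL_cons]
    refine ((spow_qcomm (h _ (by omega) (by push_cast; omega)) (he _)).mul_right
      (ih fun a h1 h2 => h a h1 (by push_cast; omega))).congr ?_
    rw [Finset.sum_range_succ]
    ring

/-- Remove one segment. -/
def dec (e : ℤ → ℤ → ℤ) (a₀ b₀ : ℤ) : ℤ → ℤ → ℤ :=
  fun a b => e a b - if a = a₀ ∧ b = b₀ then 1 else 0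

/-- Add one segment. -/
def inc (e : ℤ → ℤ → ℤ) (a₀ b₀ : ℤ) : ℤ → ℤ → ℤ :=
  fun a b => e a b + if a = a₀ ∧ b = b₀ then 1 else 0

theorem dec_self (e : ℤ → ℤ → ℤ) (a b : ℤ) : dec e a b a b = e a b - 1 := by simp [dec]

theorem inc_self (e : ℤ → ℤ → ℤ) (a b : ℤ) : inc e a b a b = e a b + 1 := by simp [inc]

theorem dec_of_ne (e : ℤ → ℤ → ℤ) {a b a₀ b₀ : ℤ} (h : a ≠ a₀ ∨ b ≠ b₀) :
    dec e a₀ b₀ a b = e a b := by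
  rw [dec, if_neg (by omega), sub_zero]

theorem inc_of_ne (e : ℤ → ℤ → ℤ) {a b a₀ b₀ : ℤ} (h : a ≠ a₀ ∨ b ≠ b₀) :
    inc e a₀ b₀ a b = e a b := by
  rw [inc, if_neg (by omega), add_zero]

theorem PL_dec {L : List (ℤ × ℤ)} (e : ℤ → ℤ → ℤ) {a₀ b₀ : ℤ} (h : (a₀, b₀) ∉ L) :
    PL L (dec e a₀ b₀) = PL L e :=
  PL_congr fun a b hab => dec_of_ne e (by
    by_contra! hc
    exact h (hc.1 ▸ hc.2 ▸ hab))

theorem PL_inc {L : List (ℤ × ℤ)} (e : ℤ → ℤ → ℤ) {a₀ b₀ : ℤ} (h : (a₀, b₀) ∉ L) :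
    PL L (inc e a₀ b₀) = PL L e :=
  PL_congr fun a b hab => inc_of_ne e (by
    by_contra! hc
    exact h (hc.1 ▸ hc.2 ▸ hab))

section Abstract

variable {A : Type*} [Ring A] [Algebra K A]

/-- Commuting `E` past `X^{(a)} Y^{(b)}` when `E` turns `Y` into `X`. -/
theorem E_mul_dpow_mul_dpow {E X Y : A} (hX : QComm 1 E X)
    (hY : E * Y = q ^ (-1 : ℤ) • (Y * E) + (1 - q ^ 2) • X) (hYX : QComm (-1) Y X)
    {a b : ℤ} (ha : 0 ≤ a) (hb : 0 ≤ b) :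
    E * (dpow qnum X a * dpow qnum Y b) =
      q ^ (a - b) • (dpow qnum X a * dpow qnum Y b * E) +
      ((1 - q ^ 2) * qint (a + 1) * q ^ (1 + (a - b))) •
        (dpow qnum X (a + 1) * dpow qnum Y (b - 1)) := by
  have hq := q_ne_zero
  have h1 := hX.dpow_right qnum ha
  have h2 := E_mul_dpow_left hY (hYX.smul_right _) hb
  obtain ⟨a, rfl⟩ := Int.eq_ofNat_of_zero_le ha
  have h3 : dpow qnum X a * X = qint (a + 1) • dpow qnum X (a + 1) := by
    rw [((QComm.refl X).dpow_left qnum ha |>.congr (zero_mul _)).eq, mul_dpow qnum_ne_zero]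
    rfl
  rw [← mul_assoc, h1, one_mul, smul_mul_assoc, mul_assoc, h2, mul_add, mul_smul_comm,
    mul_smul_comm, smul_mul_assoc, mul_smul_comm, ← mul_assoc, ← mul_assoc (dpow qnum X a) X, h3,
    smul_mul_assoc]
  simp only [smul_add, smul_smul]
  congr 2
  · rw [← zpow_add₀ hq, sub_eq_add_neg]
  · rw [show (1 : ℤ) + (a - b) = a + (1 - b) by ring, zpow_add₀ hq]
    ring

theorem mul_block {E R S R' P : A} {c d : K} (h1 : QComm 0 E R) (h2 : QComm 0 E P)
    (h : E * S = c • (S * E) + d • R') :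
    E * (R * (S * P)) = c • (R * (S * P) * E) + d • (R * (R' * P)) := by
  rw [← mul_assoc, h1.eq, mul_assoc, ← mul_assoc E, h, add_mul, mul_add, smul_mul_assoc,
    smul_mul_assoc, mul_smul_comm, mul_smul_comm, mul_assoc S, h2.eq]
  simp only [mul_assoc]

end Abstract

/-- All the segments `⟨2a+1,2b+1⟩` with `-b-1 ≤ a ≤ b`, in decreasing order. -/
def fullRow (b : ℕ) : List (ℤ × ℤ) := dl (-b - 1) b (2 * b + 2)

theorem fullRow_split (n t : ℕ) :
    fullRow (n + 1 + t) = dl (-n + 1) (n + 1 + t : ℕ) (2 * n + 1 + t) ++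
      ([(-(n : ℤ), ((n + 1 + t : ℕ) : ℤ)), (-n - 1, ((n + 1 + t : ℕ) : ℤ))] ++
        dl (-(n + 1 + t : ℕ) - 1) (n + 1 + t : ℕ) (t + 1)) := by
  rw [fullRow, show 2 * (n + 1 + t) + 2 = (2 * n + 1 + t) + (2 + (t + 1)) by ring, dl_add,
    dl_add _ _ 2, dl, dl, dl]
  push_cast
  rw [show -(n + 1 + t : ℤ) - 1 + (2 + (t + 1)) = -n + 1 by ring,
    show -(n + 1 + t : ℤ) - 1 + (t + 1) + 1 = -n by ring,
    show -(n + 1 + t : ℤ) - 1 + (t + 1) + 0 = -n - 1 by ring]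

theorem E_mul_fullRow (n t : ℕ) {e : ℤ → ℤ → ℤ} (he : ∀ a b, 0 ≤ e a b) {b : ℤ}
    (hb : b = (n + 1 + t : ℕ)) :
    eE n * PL (fullRow (n + 1 + t)) e =
      q ^ (e (-n) b - e (-n - 1) b) • (PL (fullRow (n + 1 + t)) e * eE n) +
      ((1 - q ^ 2) * qint (e (-n) b + 1) * q ^ (1 + (e (-n) b - e (-n - 1) b))) •
        PL (fullRow (n + 1 + t)) (inc (dec e (-n - 1) b) (-n) b) := by
  rw [fullRow_split, ← hb]
  simp only [PL_append, PL_cons, PL_nil, mul_one]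
  rw [PL_inc, PL_dec, PL_inc, PL_dec, inc_self, inc_of_ne, dec_self, dec_of_ne,
    spow_of_ne, spow_of_ne, spow_of_ne, spow_of_ne]
  · refine mul_block ?_ ?_ (E_mul_dpow_mul_dpow (eE_fseg_outer_left ?_ ?_)
      (eE_fseg_outer_neg ?_ ?_) (fseg_same_last ?_ ?_) (he _ _) (he _ _))
    · refine PL_qcomm_zero (fun x y hxy => ?_) _
      rw [mem_dl] at hxy
      obtain ⟨rfl, h1, h2⟩ := hxy
      push_cast at h2
      exact eE_fseg_outer_mid (by omega) (by omega) (by omega) (by omega)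
    · refine PL_qcomm_zero (fun x y hxy => ?_) _
      rw [mem_dl] at hxy
      obtain ⟨rfl, h1, h2⟩ := hxy
      push_cast at h2
      exact eE_fseg_far (by omega) (by omega) (by omega)
    all_goals omega
  all_goals first | omega | (rw [mem_dl]; omega)

/-- All the segments `⟨2a+1,2b+1⟩` with `-b-1 ≤ a ≤ b` and `b < N`, in decreasing order. -/
def fullList : ℕ → List (ℤ × ℤ)
  | 0 => []
  | N + 1 => fullRow N ++ fullList N

/-- The rows `n < b ≤ n + R` of `fullList`. -/
def upperList (n : ℕ) : ℕ → List (ℤ × ℤ)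
  | 0 => []
  | R + 1 => fullRow (n + 1 + R) ++ upperList n R

theorem fullList_eq (n R : ℕ) :
    fullList (n + 1 + R) = upperList n R ++ (fullRow n ++ fullList n) := by
  induction R with
  | zero => rfl
  | succ R ih => rw [← add_assoc, fullList, ih, upperList, List.append_assoc]

theorem mem_fullList {N : ℕ} {a b : ℤ} :
    (a, b) ∈ fullList N ↔ -b - 1 ≤ a ∧ a ≤ b ∧ b < N := by
  induction N with
  | zero => simp [fullList]; omega
  | succ N ih => rw [fullList, List.mem_append, ih, fullRow, mem_dl]; push_cast; omega

theorem mem_upperList {n R : ℕ} {a b : ℤ} (h : (a, b) ∈ upperList n R) : n < b ∧ b ≤ n + R := by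
  induction R with
  | zero => simp [upperList] at h
  | succ R ih =>
    rw [upperList, List.mem_append, fullRow, mem_dl] at h
    push_cast at h ⊢
    rcases h with h | h
    · omega
    · have := ih h; omega

theorem E_mul_upperList (n : ℕ) {e : ℤ → ℤ → ℤ} (he : ∀ a b, 0 ≤ e a b) (R : ℕ) :
    eE n * PL (upperList n R) e =
      q ^ (∑ s ∈ Finset.range R, (e (-n) (n + 1 + s) - e (-n - 1) (n + 1 + s))) •
          (PL (upperList n R) e * eE n) +
      ∑ t ∈ Finset.range R, ((1 - q ^ 2) * qint (e (-n) (n + 1 + t) + 1) *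
          q ^ (1 + ∑ s ∈ Finset.Ico t R, (e (-n) (n + 1 + s) - e (-n - 1) (n + 1 + s)))) •
        PL (upperList n R) (inc (dec e (-n - 1) (n + 1 + t)) (-n) (n + 1 + t)) := by
  have hq := q_ne_zero
  induction R with
  | zero => simp [upperList, PL_nil]
  | succ R ih =>
    have hrow := E_mul_fullRow n R he (b := n + 1 + R) (by push_cast; ring)
    simp only [upperList, PL_append]
    rw [← mul_assoc, hrow, add_mul, smul_mul_assoc, mul_assoc, ih, mul_add, smul_add,
      Finset.sum_range_succ, Finset.sum_range_succ, mul_smul_comm, smul_smul, add_assoc,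
      ← zpow_add₀ hq]
    congr 1
    · rw [mul_assoc, add_comm]
    congr 1
    · rw [Finset.mul_sum, Finset.smul_sum]
      refine Finset.sum_congr rfl fun t ht => ?_
      rw [Finset.mem_range] at ht
      rw [mul_smul_comm, smul_smul, Finset.sum_Ico_succ_top ht.le,
        PL_inc (L := fullRow (n + 1 + R)), PL_dec (L := fullRow (n + 1 + R))]
      · congr 1
        rw [← add_assoc 1, zpow_add₀ hq (1 + _)]
        ring
      all_goals rw [fullRow, mem_dl]; push_cast; omega
    · rw [smul_mul_assoc, Nat.Ico_succ_singleton, Finset.sum_singleton,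
        PL_inc (L := upperList n R), PL_dec (L := upperList n R)]
      all_goals
        intro h
        have := mem_upperList h
        omega

end Products

section RowAction

attribute [local instance] algebraNatK algebraIntK

section Abstract

variable {A : Type*} [Ring A] [Algebra K A]
variable {V : Type*} [AddCommGroup V] [Module K V] [Module A V] [IsScalarTower K A V]

theorem two_block_smul {E T X Y Y' M P P' P'' : A} {x t τ : ℤ} {α β μ c : K} {u u' : V}
    (hP : E * P = q ^ x • (P * E) + c • (P' * (M * T)))
    (hY : E • Y • u = α • X • Y' • u) (hPX : P * X = β • P'') (hTY : QComm t T Y)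
    (hT : T • u = q ^ τ • u) (hMY : QComm 0 M Y) (hM : M • u = μ • u') :
    E • (P * Y) • u =
      (q ^ x * α * β) • (P'' * Y') • u + (c * q ^ (t + τ) * μ) • (P' * Y) • u' := by
  have h : T • Y • u = q ^ (t + τ) • Y • u := by
    rw [smul_smul, hTY, smul_assoc, mul_smul, hT, smul_comm Y (_ : K), smul_smul,
      ← zpow_add₀ q_ne_zero]
  rw [mul_smul, smul_smul E, hP, add_smul, smul_assoc, smul_assoc, mul_smul P E, mul_smul P',
    mul_smul M, hY, h, smul_comm P α, smul_smul P X, hPX, smul_assoc β, smul_comm M (_ : K),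
    smul_comm P' (_ : K), smul_smul M, hMY.eq, mul_smul Y, hM, smul_comm Y μ, smul_comm P' μ,
    mul_smul P' Y, mul_smul P'' Y']
  simp only [smul_smul (_ : K) (_ : K), mul_assoc]

theorem row_smul {E T Z Z' P : A} {r : ℕ} {Pd W : ℕ → A} {c γ : ℕ → K} {α β c₀ : K} {S τ : ℤ}
    {v v₁ v₂ : V} {w : ℕ → V}
    (hZ : E * Z = Z * E + c₀ • (Z' * T))
    (hP : E * P = P * E + ∑ s ∈ Finset.range r, c s • (Pd s * W s * T))
    (hTP : QComm S T P) (hT : T • v = q ^ τ • v) (hE : E • v = α • v₁ + β • v₂)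
    (hW : ∀ s ∈ Finset.range r, W s • v = γ s • w s) :
    E • (Z * P) • v = α • (Z * P) • v₁ +
      ∑ s ∈ Finset.range r, (c s * q ^ τ * γ s) • (Z * Pd s) • w s +
      β • (Z * P) • v₂ + (c₀ * q ^ (S + τ)) • (Z' * P) • v := by
  have h : T • P • v = q ^ (S + τ) • P • v := by
    rw [smul_smul, hTP, smul_assoc, mul_smul, hT, smul_comm P (_ : K), smul_smul,
      ← zpow_add₀ q_ne_zero]
  rw [mul_smul, smul_smul E, hZ, add_smul, smul_assoc, mul_smul Z E, mul_smul Z' T, h,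
    smul_comm Z' (_ : K), smul_smul E, hP, add_smul, Finset.sum_smul, smul_add, Finset.smul_sum,
    mul_smul P E, hE, smul_add, smul_add, smul_comm P α, smul_comm P β, smul_comm Z α,
    smul_comm Z β, mul_smul Z P, mul_smul Z P, mul_smul Z' P, smul_smul c₀]
  rw [add_right_comm (α • Z • P • v₁)]
  congr 3
  refine Finset.sum_congr rfl fun s hs => ?_
  rw [smul_assoc, mul_smul _ T, hT, smul_comm _ (q ^ τ), smul_smul (c s), smul_comm Z (_ : K),
    mul_smul (Pd s), hW s hs, smul_comm (Pd s) (_ : K), smul_comm Z (γ s), smul_smul _ (γ s),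
    mul_smul Z]

end Abstract

theorem spow_mul_self {a b e : ℤ} (he : 0 ≤ e) :
    fseg a b * spow a b e =
      qint (if a = -b - 1 then 2 * (e + 1) else e + 1) • spow a b (e + 1) := by
  obtain ⟨e, rfl⟩ := Int.eq_ofNat_of_zero_le he
  unfold spow
  split_ifs
  · exact mul_dpow qnumEven_ne_zero (fseg a b) e
  · exact mul_dpow qnum_ne_zero (fseg a b) e

theorem fseg_mul_dl {lo b : ℤ} {len s : ℕ} (hs : s < len) (hlen : lo + len ≤ b + 1)
    {e : ℤ → ℤ → ℤ} (he : ∀ a b, 0 ≤ e a b) {a : ℤ} (ha : a = lo + s) :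
    fseg a b * PL (dl lo b len) e =
      (q ^ (-∑ s' ∈ Finset.Ico (s + 1) len, e (lo + s') b) *
        qint (if a = -b - 1 then 2 * (e a b + 1) else e a b + 1)) •
        PL (dl lo b len) (inc e a b) := by
  subst ha
  induction len with
  | zero => omega
  | succ len ih =>
    rw [dl, PL_cons, PL_cons]
    rcases Nat.lt_succ_iff_lt_or_eq.mp hs with h | rfl
    · have h1 := spow_qcomm (fseg_same_last (a := lo + s) (a' := lo + len) (b := b) (by omega)
        (by push_cast at hlen; omega)) (he (lo + len) b)
      dsimp only
      rw [inc_of_ne _ (by omega), ← mul_assoc, h1, smul_mul_assoc, mul_assoc,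
        ih h (by push_cast at hlen; omega), mul_smul_comm, smul_smul,
        Finset.sum_Ico_succ_top (by omega), neg_add, add_comm, zpow_add₀ q_ne_zero, neg_one_mul]
      congr 1
      ring
    · rw [Finset.Ico_self, Finset.sum_empty, neg_zero, zpow_zero, one_mul, ← mul_assoc,
        spow_mul_self (he _ _), PL_inc, inc_self, smul_mul_assoc]
      rw [mem_dl]; omega

/-- The action of `E_{-k}` on the middle part of the row of segments ending at `k`. -/
theorem eE_mul_dl {n lo : ℤ} {len : ℕ} (hlo : -n < lo) (hlen : lo + len ≤ n)
    {e : ℤ → ℤ → ℤ} (he : ∀ a b, 0 ≤ e a b) :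
    eE n * PL (dl lo n len) e = PL (dl lo n len) e * eE n +
      ∑ s ∈ Finset.range len,
        ((1 - q ^ 2) * q ^ (1 - ∑ s' ∈ Finset.range (s + 1), e (lo + s') n)) •
          (PL (dl lo n len) (dec e (lo + s) n) * fseg (lo + s) (n - 1) * tT n) := by
  have hq := q_ne_zero
  induction len with
  | zero => simp [dl, PL_nil]
  | succ len ih =>
    push_cast at hlen
    have hS : eE n * fseg (lo + len) n = q ^ (0 : ℤ) • (fseg (lo + len) n * eE n) +
        (1 - q ^ 2) • (fseg (lo + len) (n - 1) * tT n) := by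
      rw [zpow_zero, one_smul]
      exact eE_fseg_mid (by omega) (by omega)
    have hf : QComm (-1) (fseg (lo + len) (n - 1)) (fseg (lo + len) n) := by
      have := fseg_same_first (a := lo + len) (b := n - 1) (by omega)
      rwa [sub_add_cancel] at this
    have hT : ∀ a, -n < a → a < n → QComm (-1) (tT n) (fseg a n) := fun a h1 h2 =>
      tT_fseg_of (by omega) (by unfold cform; split_ifs <;> omega)
    have h1 := E_mul_dpow_right hS (((hf.mul_left (hT _ (by omega) (by omega))).symm.smul_right
      (1 - q ^ 2)).symm.congr (by norm_num)) (he (lo + len) n)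
    rw [← spow_of_ne (by omega), ← spow_of_ne (by omega), zero_mul, zpow_zero, one_smul] at h1
    have h2 : QComm (-∑ s ∈ Finset.range len, e (lo + s) n)
        (fseg (lo + len) (n - 1) * tT n) (PL (dl lo n len) e) := by
      refine (QComm.mul_left (PL_qcomm_zero ?_ e)
        (PL_dl_qcomm (fun a h1 h2 => hT a (by omega) (by omega)) fun a => he a n)).congr (by ring)
      intro a b hab
      rw [mem_dl] at hab
      obtain ⟨rfl, h3, h4⟩ := hab
      exact fseg_interior (by omega) (by omega) (by omega)
    rw [dl, PL_cons, ← mul_assoc, h1, add_mul, mul_assoc _ (eE n), ih (by omega), mul_add,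
      Finset.sum_range_succ, Finset.mul_sum, ← mul_assoc, add_assoc]
    congr 2
    · refine Finset.sum_congr rfl fun s hs => ?_
      rw [Finset.mem_range] at hs
      rw [PL_cons, dec_of_ne _ (by left; dsimp only; omega), mul_smul_comm]
      simp only [mul_assoc]
    · rw [PL_cons, PL_dec, dec_self, Finset.sum_range_succ, smul_mul_assoc, mul_assoc,
        smul_mul_assoc, h2, mul_smul_comm, smul_smul, mul_smul_comm, smul_smul]
      · simp only [mul_assoc]
        congr 1
        rw [mul_left_comm, ← zpow_add₀ hq]
        congr 2; ring
      · rw [mem_dl]; omega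

end RowAction

section Vacuum

attribute [local instance] algebraNatK algebraIntK

section Abstract

variable {A : Type*} [Ring A] [Algebra K A]
variable {V : Type*} [AddCommGroup V] [Module K V] [Module A V] [IsScalarTower K A V]

theorem QComm.smul_smul_eq {c : ℤ} {x P : A} (h : QComm c x P) (v : V) :
    x • P • v = q ^ c • P • x • v := by
  rw [smul_smul, h, smul_assoc, mul_smul]

theorem QComm.smul_eq {c : ℤ} {x P : A} (h : QComm c x P) {v : V} {t : ℤ} (hv : x • v = q ^ t • v) :
    x • P • v = q ^ (c + t) • P • v := by
  rw [h.smul_smul_eq, hv, smul_comm P (_ : K), smul_smul, ← zpow_add₀ q_ne_zero]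

theorem QComm.smul_eq_of_zero {x P : A} (h : QComm 0 x P) {v w : V} {c : K} (hv : x • v = c • w) :
    x • P • v = c • P • w := by
  rw [h.smul_smul_eq, hv, zpow_zero, one_smul, smul_comm P (_ : K)]

theorem smul_reflect {W X P D : A} {v : V} {a b c : ℤ} (hW : QComm a W P) (hX : QComm b X P)
    (hWD : QComm 0 W D) (hXD : QComm 0 X D) (hv : W • v = q ^ (-1 : ℤ) • X • v)
    (hc : a - b - 1 = c) :
    W • (P * D) • v = q ^ c • X • (P * D) • v := by
  rw [mul_smul, hW.smul_smul_eq, hX.smul_smul_eq, smul_smul_of_comm hWD, smul_smul_of_comm hXD, hv,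
    smul_comm D (_ : K), smul_comm P (_ : K), smul_smul (_ : K) (_ : K), smul_smul (_ : K) (_ : K),
    ← zpow_add₀ q_ne_zero, ← zpow_add₀ q_ne_zero]
  congr 2
  omega

end Abstract

theorem fullRow_eq (N : ℕ) : fullRow N = dl (-N) N (2 * N + 1) ++ [(-(N : ℤ) - 1, (N : ℤ))] := by
  rw [fullRow, show 2 * N + 2 = 2 * N + 1 + 1 by ring, dl_add, dl.eq_def (-(N : ℤ) - 1) N 1]
  simp [dl.eq_def (-(N : ℤ) - 1) N 0]

/-- The weight of `T_{-(2N+3)}` on the part of a PBW monomial in the rows up to `2N+1`. -/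
def tw (N : ℕ) (e : ℤ → ℤ → ℤ) : ℤ :=
  ∑ s ∈ Finset.range (2 * N + 1), e (-N + s) N + 2 * e (-N - 1) N

theorem PL_fullRow_qcomm {N : ℕ} {x : U} {c d : ℤ} {e : ℤ → ℤ → ℤ} (he : ∀ a b, 0 ≤ e a b)
    (h : ∀ a : ℤ, -N ≤ a → a ≤ N → QComm c x (fseg a N)) (h' : QComm d x (fseg (-N - 1) N)) :
    QComm (c * ∑ s ∈ Finset.range (2 * N + 1), e (-N + s) N + d * e (-N - 1) N) x
      (PL (fullRow N) e) := by
  rw [fullRow_eq, PL_append, PL_cons, PL_nil, mul_one]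
  exact (PL_dl_qcomm (fun a h1 h2 => h a (by omega) (by push_cast at h2; omega))
    fun a => he a N).mul_right (spow_qcomm h' (he _ _))

theorem PL_fullList_qcomm_zero {N : ℕ} {x : U}
    (h : ∀ a b : ℤ, -b - 1 ≤ a → a ≤ b → b < N → QComm 0 x (fseg a b)) (e : ℤ → ℤ → ℤ) :
    QComm 0 x (PL (fullList N) e) :=
  PL_qcomm_zero (fun a b hab => by
    rw [mem_fullList] at hab
    exact h a b hab.1 hab.2.1 hab.2.2) e

section

variable {e : ℤ → ℤ → ℤ} (he : ∀ a b, 0 ≤ e a b)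
include he

theorem eE_smul_fullList (N : ℕ) : eE (N + 1) • PL (fullList (N + 1)) e • phi = 0 := by
  have h1 := PL_fullRow_qcomm (N := N) (x := eE (N + 1)) (c := 0) (d := 1) he
    (fun a h1 h2 => eE_fseg_inner (by omega) h2 (by omega))
    (by
      have := eE_fseg_edge (n := (N : ℤ) + 1) (b := N) (by omega) (by omega)
      rwa [show -(N + 1 : ℤ) = -N - 1 by ring] at this)
  have h2 := PL_fullList_qcomm_zero (N := N) (x := eE (N + 1))
    (fun a b h1 h2 h3 => eE_fseg_inner (by omega) h2 (by omega)) e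
  have h3 := (h1.mul_right h2).smul_smul_eq (V := Vt) phi
  rw [fullList, PL_append, h3, eE_smul_phi]
  exact (congrArg _ (smul_zero _)).trans (smul_zero _)

theorem tT_smul_fullList (N : ℕ) :
    tT (N + 1) • PL (fullList (N + 1)) e • phi = q ^ tw N e • PL (fullList (N + 1)) e • phi := by
  have h1 := PL_fullRow_qcomm (N := N) (x := tT (N + 1)) (c := 1) (d := 2) he
    (fun a h1 h2 => tT_fseg_of (by omega) (by unfold cform; split_ifs <;> omega))
    (tT_fseg_of (by omega) (by unfold cform; split_ifs <;> omega))
  have h2 := PL_fullList_qcomm_zero (N := N) (x := tT (N + 1))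
    (fun a b h1 h2 h3 => tT_fseg_of (by omega) (by unfold cform; split_ifs <;> omega)) e
  have h3 := ((h1.mul_right h2).congr (e' := tw N e) (by unfold tw; ring)).smul_smul_eq
    (V := Vt) phi
  rw [fullList, PL_append, h3, tT_smul_phi]

theorem fseg_reflect_fullList (N : ℕ) :
    fseg (-N - 2) N • PL (fullList (N + 1)) e • phi =
      q ^ (-1 - tw N e) • fseg (-N - 1) (N + 1) • PL (fullList (N + 1)) e • phi := by
  have h := fseg_reflect (n := N + 1) (by omega)
  push_cast at h
  rw [show (-(N + 1) - 1 : ℤ) = -N - 2 by ring, show (-(N + 1) : ℤ) = -N - 1 by ring,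
    add_sub_cancel_right] at h
  rw [fullList, PL_append]
  refine smul_reflect (V := Vt)
    (PL_fullRow_qcomm he (fun a h1 h2 => fseg_same_last (by omega) h2)
      (fseg_same_last (by omega) (by omega)))
    (PL_fullRow_qcomm he (fun a h1 h2 =>
      ((fseg_interior (by omega) h2 (by omega)).symm).congr neg_zero)
      ((fseg_same_first (by omega)).symm))
    (PL_fullList_qcomm_zero (fun a b h1 h2 h3 =>
      ((fseg_interior (by omega) h2 (by omega)).symm).congr neg_zero) e)
    (PL_fullList_qcomm_zero (fun a b h1 h2 h3 =>
      ((fseg_interior (by omega) h2 (by omega)).symm).congr neg_zero) e) h ?_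
  unfold tw
  ring

end

/-- Multiplication by a segment on the left of a row ending with the same vertex. -/
theorem fseg_mul_fullRow {e : ℤ → ℤ → ℤ} (he : ∀ a b, 0 ≤ e a b) {N s : ℕ}
    (hs : s < 2 * N + 2) {a : ℤ} (ha : a = -N - 1 + s) :
    fseg a N * PL (fullRow N) e =
      (q ^ (-∑ s' ∈ Finset.Ico (s + 1) (2 * N + 2), e (-N - 1 + s') N) *
        qint (if a = -N - 1 then 2 * (e a N + 1) else e a N + 1)) •
        PL (fullRow N) (inc e a N) :=
  fseg_mul_dl hs (by push_cast; omega) he ha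

end Vacuum

section LowerRows

attribute [local instance] algebraNatK algebraIntK

theorem spow_mul_self' {a b e : ℤ} (h : a ≠ -b - 1) (he : 0 ≤ e) :
    spow a b e * fseg a b = qint (e + 1) • spow a b (e + 1) := by
  rw [← ((spow_qcomm_zero (QComm.refl (fseg a b)) e)).eq, spow_mul_self he, if_neg h]

theorem fullRow_succ_eq (N : ℕ) :
    fullRow (N + 1) = ((N : ℤ) + 1, (N : ℤ) + 1) :: (dl (-N) (N + 1) (2 * N + 1) ++
      [(-(N : ℤ) - 1, (N : ℤ) + 1), (-(N : ℤ) - 2, (N : ℤ) + 1)]) := by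
  rw [fullRow, show 2 * (N + 1) + 2 = 1 + (2 * N + 1) + 2 by ring, dl_add, dl_add, dl, dl, dl, dl,
    dl, dl]
  push_cast
  rw [show -(N + 1 : ℤ) - 1 + 2 + (2 * N + 1) + 0 = N + 1 by ring,
    show -(N + 1 : ℤ) - 1 + 1 = -N - 1 by ring, show -(N + 1 : ℤ) - 1 + 0 = -N - 2 by ring,
    show -(N + 1 : ℤ) - 1 + 2 = -N by ring]
  rfl

theorem PL_fullList_smul (N : ℕ) (e : ℤ → ℤ → ℤ) :
    PL (fullList (N + 2)) e • phi =
      (spow (N + 1) (N + 1) (e (N + 1) (N + 1)) * PL (dl (-N) (N + 1) (2 * N + 1)) e) •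
        (spow (-N - 1) (N + 1) (e (-N - 1) (N + 1)) *
          spow (-N - 2) (N + 1) (e (-N - 2) (N + 1))) • PL (fullList (N + 1)) e • phi := by
  rw [fullList, fullRow_succ_eq, PL_append, PL_cons, PL_append, PL_cons, PL_cons, PL_nil, mul_one,
    mul_smul, mul_smul, mul_smul, mul_smul, mul_smul]

theorem PL_fullList_smul' (N : ℕ) {e e₁ e₂ : ℤ → ℤ → ℤ} {z x y : ℤ} (hz : e (N + 1) (N + 1) = z)
    (hx : e (-N - 1) (N + 1) = x) (hy : e (-N - 2) (N + 1) = y)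
    (h₁ : ∀ a : ℤ, -N ≤ a → a ≤ N → e a (N + 1) = e₁ a (N + 1))
    (h₂ : ∀ a b : ℤ, b ≤ N → e a b = e₂ a b) :
    PL (fullList (N + 2)) e • phi =
      (spow (N + 1) (N + 1) z * PL (dl (-N) (N + 1) (2 * N + 1)) e₁) •
        (spow (-N - 1) (N + 1) x * spow (-N - 2) (N + 1) y) •
          PL (fullList (N + 1)) e₂ • phi := by
  have h₃ : PL (dl (-N) (N + 1) (2 * N + 1)) e = PL (dl (-N) (N + 1) (2 * N + 1)) e₁ := by
    refine PL_congr fun a b hab => ?_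
    rw [mem_dl] at hab
    obtain ⟨rfl, h, h'⟩ := hab
    push_cast at h'
    exact h₁ a h (by omega)
  have h₄ : PL (fullList (N + 1)) e = PL (fullList (N + 1)) e₂ := by
    refine PL_congr fun a b hab => ?_
    rw [mem_fullList] at hab
    push_cast at hab
    exact h₂ a b (by omega)
  rw [PL_fullList_smul, hz, hx, hy, h₃, h₄]

variable {e : ℤ → ℤ → ℤ} (he : ∀ a b, 0 ≤ e a b)
include he

theorem eE_smul_spow_even (N : ℕ) {y : ℤ} (hy : 0 ≤ y) :
    eE (N + 1) • spow (-N - 2) (N + 1) y • PL (fullList (N + 1)) e • phi =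
      ((1 - q ^ 2) * q ^ (1 - 2 * y)) • fseg (-N - 1) (N + 1) •
        spow (-N - 2) (N + 1) (y - 1) • PL (fullList (N + 1)) e • phi := by
  rw [spow_of_eq (by ring), spow_of_eq (by ring)]
  have h := eE_fseg_sym (n := (N : ℤ) + 1) (by omega)
  rw [show -(N + 1 : ℤ) - 1 = -N - 2 by ring, show -(N + 1 : ℤ) = -N - 1 by ring,
    add_sub_cancel_right] at h
  exact E_mul_dpow_even (V := Vt) h (fseg_same_last (by omega) (by omega))
    (fseg_same_first (by omega)) (tT_fseg_of (by omega) (by unfold cform; split_ifs <;> omega))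
    (eE_smul_fullList he N) (tT_smul_fullList he N) (fseg_reflect_fullList he N) hy

theorem fseg_smul_fullList {N s : ℕ} (hs : s < 2 * N + 2) {a : ℤ} (ha : a = -N - 1 + s) :
    fseg a N • PL (fullList (N + 1)) e • phi =
      (q ^ (-∑ s' ∈ Finset.Ico (s + 1) (2 * N + 2), e (-N - 1 + s') N) *
        qint (if a = -N - 1 then 2 * (e a N + 1) else e a N + 1)) •
        PL (fullList (N + 1)) (inc e a N) • phi := by
  have h : PL (fullList (N + 1)) (inc e a N) = PL (fullRow N) (inc e a N) * PL (fullList N) e := by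
    rw [fullList, PL_append, PL_inc (L := fullList N)]
    rw [mem_fullList]; omega
  rw [h, fullList, PL_append, smul_smul, ← mul_assoc, fseg_mul_fullRow he hs ha, smul_mul_assoc,
    smul_assoc]

theorem eE_smul_edges (N : ℕ) :
    eE (N + 1) • (spow (-N - 1) (N + 1) (e (-N - 1) (N + 1)) *
          spow (-N - 2) (N + 1) (e (-N - 2) (N + 1))) • PL (fullList (N + 1)) e • phi =
      ((1 - q ^ 2) * qint (e (-N - 1) (N + 1) + 1) *
        q ^ (1 + e (-N - 1) (N + 1) - 2 * e (-N - 2) (N + 1))) •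
        (spow (-N - 1) (N + 1) (e (-N - 1) (N + 1) + 1) *
          spow (-N - 2) (N + 1) (e (-N - 2) (N + 1) - 1)) • PL (fullList (N + 1)) e • phi +
      ((1 - q ^ 2) * qint (2 * (e (-N - 1) N + 1)) *
        q ^ (1 + 2 * e (-N - 1) N - 2 * e (-N - 2) (N + 1))) •
        (spow (-N - 1) (N + 1) (e (-N - 1) (N + 1) - 1) *
          spow (-N - 2) (N + 1) (e (-N - 2) (N + 1))) •
          PL (fullList (N + 1)) (inc e (-N - 1) N) • phi := by
  have hq := q_ne_zero
  have hX := eE_fseg_left (n := (N : ℤ) + 1) (by omega)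
  rw [show -(N + 1 : ℤ) = -N - 1 by ring, add_sub_cancel_right, smul_add] at hX
  have hM : QComm (1 - 2) (q ^ (1 : ℤ) • (1 - q ^ 2) • (fseg (-N - 1) N * tT (N + 1)))
      (fseg (-N - 1) (N + 1)) := by
    refine (((QComm.mul_left (fseg_same_first (by omega)) (tT_fseg_of (e := 0) (by omega)
      (by unfold cform; split_ifs <;> omega))).symm.smul_right _).smul_right _).symm.congr
      (by norm_num)
  have hP := E_mul_dpow_right hX hM (he (-N - 1) (N + 1))
  rw [← spow_of_ne (by omega), ← spow_of_ne (by omega), mul_smul_comm, mul_smul_comm, smul_smul,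
    smul_smul] at hP
  have hMu := fseg_smul_fullList he (N := N) (s := 0) (by omega) (a := -N - 1) (by simp)
  rw [if_pos rfl] at hMu
  have hT := spow_qcomm (tT_fseg_of (n := N + 1) (a := -N - 2) (b := N + 1) (e := -2) (by omega)
    (by unfold cform; split_ifs <;> omega)) (he (-N - 2) (N + 1))
  refine (two_block_smul (V := Vt) hP (eE_smul_spow_even he N (he _ _))
    (spow_mul_self' (by omega) (he _ _)) hT (tT_smul_fullList he N)
    (spow_qcomm_zero (fseg_interior (by omega) (by omega) (by omega)) _) hMu).trans ?_
  congr 2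
  · rw [show 1 + e (-N - 1) (N + 1) - 2 * e (-N - 2) (N + 1) =
      e (-N - 1) (N + 1) + (1 - 2 * e (-N - 2) (N + 1)) by ring, zpow_add₀ hq (e _ _), one_mul]
    ring
  · rw [sub_self, zero_mul, zpow_zero, one_mul, tw, Finset.sum_Ico_eq_sum_range]
    have : ∑ s ∈ Finset.range (2 * N + 2 - (0 + 1)), e (-N - 1 + ((0 + 1 + s : ℕ) : ℤ)) N =
        ∑ s ∈ Finset.range (2 * N + 1), e (-N + s) N :=
      Finset.sum_congr rfl fun s _ => by congr 1; push_cast; ring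
    rw [this]
    generalize ∑ s ∈ Finset.range (2 * N + 1), e (-N + s) N = S
    rw [show 1 + 2 * e (-N - 1) N - 2 * e (-N - 2) (N + 1) =
      1 + (-2 * e (-N - 2) (N + 1) + (S + 2 * e (-N - 1) N)) + -S by ring, zpow_add₀ hq _ (-S),
      zpow_add₀ hq 1]
    ring

/-- The action of `E_{-k}` on a PBW monomial in the rows up to `k = 2N+3`. -/
theorem eE_smul_lower (N : ℕ) :
    eE (N + 1) • PL (fullList (N + 2)) e • phi =
      ((1 - q ^ 2) * qint (e (-N - 1) (N + 1) + 1) *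
        q ^ (1 + e (-N - 1) (N + 1) - 2 * e (-N - 2) (N + 1))) •
        PL (fullList (N + 2)) (inc (dec e (-N - 2) (N + 1)) (-N - 1) (N + 1)) • phi +
      ∑ s ∈ Finset.range (2 * N + 1),
        ((1 - q ^ 2) * qint (e (-N + s) N + 1) *
          q ^ (1 + 2 * e (-N - 1) N - 2 * e (-N - 2) (N + 1) +
            ∑ s' ∈ Finset.range (s + 1), (e (-N + s') N - e (-N + s') (N + 1)))) •
          PL (fullList (N + 2)) (inc (dec e (-N + s) (N + 1)) (-N + s) N) • phi +
      ((1 - q ^ 2) * qint (2 * (e (-N - 1) N + 1)) *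
        q ^ (1 + 2 * e (-N - 1) N - 2 * e (-N - 2) (N + 1))) •
        PL (fullList (N + 2)) (inc (dec e (-N - 1) (N + 1)) (-N - 1) N) • phi +
      q ^ (1 - e (N + 1) (N + 1) - 2 * e (-N - 2) (N + 1) + 2 * e (-N - 1) N +
          ∑ s ∈ Finset.range (2 * N + 1), (e (-N + s) N - e (-N + s) (N + 1))) •
        PL (fullList (N + 2)) (dec e (N + 1) (N + 1)) • phi := by
  have hq := q_ne_zero
  have hZ : eE (N + 1) * spow (N + 1) (N + 1) (e (N + 1) (N + 1)) =
      spow (N + 1) (N + 1) (e (N + 1) (N + 1)) * eE (N + 1) +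
      q ^ (1 - e (N + 1) (N + 1)) • (spow (N + 1) (N + 1) (e (N + 1) (N + 1) - 1) * tT (N + 1)) := by
    have h : eE (N + 1) * fseg (N + 1) (N + 1) =
        q ^ (0 : ℤ) • (fseg (N + 1) (N + 1) * eE (N + 1)) + tT (N + 1) := by
      rw [zpow_zero, one_smul, fseg_self]
      exact eE_mul_ff_pos (by omega)
    have := E_mul_dpow_right h (tT_fseg_of (by omega)
      (by unfold cform; split_ifs <;> omega)) (he (N + 1) (N + 1))
    rw [← spow_of_ne (by omega), ← spow_of_ne (by omega), zero_mul, zpow_zero, one_smul] at this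
    rw [this]
    congr 3; ring
  have hP := eE_mul_dl (n := N + 1) (lo := -N) (len := 2 * N + 1) (by omega)
    (by push_cast; omega) he
  rw [add_sub_cancel_right] at hP
  have hTP := PL_dl_qcomm (lo := -N) (b := N + 1) (len := 2 * N + 1) (x := tT (N + 1)) (c := -1)
    (e := e) (fun a h1 h2 => tT_fseg_of (by push_cast at h2; omega)
      (by push_cast at h2; unfold cform; split_ifs <;> omega)) fun a => he a _
  have hTv := ((spow_qcomm (tT_fseg_of (n := N + 1) (a := -N - 1) (b := N + 1) (e := 0)
    (by omega) (by unfold cform; split_ifs <;> omega)) (he (-N - 1) (N + 1))).mul_right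
    (spow_qcomm (tT_fseg_of (n := N + 1) (a := -N - 2) (b := N + 1) (e := -2)
    (by omega) (by unfold cform; split_ifs <;> omega)) (he (-N - 2) (N + 1)))).smul_eq
    (V := Vt) (tT_smul_fullList he N)
  have hW : ∀ s ∈ Finset.range (2 * N + 1), fseg (-N + s) N •
      (spow (-N - 1) (N + 1) (e (-N - 1) (N + 1)) *
        spow (-N - 2) (N + 1) (e (-N - 2) (N + 1))) • PL (fullList (N + 1)) e • phi =
      (q ^ (-∑ s' ∈ Finset.Ico (s + 1) (2 * N + 1), e (-N + s') N) * qint (e (-N + s) N + 1)) •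
      (spow (-N - 1) (N + 1) (e (-N - 1) (N + 1)) *
        spow (-N - 2) (N + 1) (e (-N - 2) (N + 1))) •
        PL (fullList (N + 1)) (inc e (-N + s) N) • phi := by
    intro s hs
    rw [Finset.mem_range] at hs
    have h := fseg_smul_fullList he (N := N) (s := s + 1) (by omega) (a := -N + s)
      (by push_cast; ring)
    have h' : ∑ s' ∈ Finset.Ico (s + 1 + 1) (2 * N + 2), e (-N - 1 + s') N =
        ∑ s' ∈ Finset.Ico (s + 1) (2 * N + 1), e (-N + s') N := by
      rw [← Finset.sum_Ico_add' _ (s + 1) (2 * N + 1) 1]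
      exact Finset.sum_congr rfl fun s _ => by congr 1; push_cast; ring
    rw [if_neg (by omega), h'] at h
    exact QComm.smul_eq_of_zero (V := Vt)
      (((spow_qcomm_zero (fseg_interior (by omega) (by omega) (by omega)) _).mul_right
        (spow_qcomm_zero (fseg_interior (by omega) (by omega) (by omega)) _)).congr
          (add_zero 0)) h
  rw [PL_fullList_smul' N (e := e) rfl rfl rfl (fun _ _ _ => rfl) fun _ _ _ => rfl]
  refine (row_smul (V := Vt) hZ hP hTP hTv (eE_smul_edges he N) hW).trans ?_
  have hmod₁ := PL_fullList_smul' N (e := inc (dec e (-N - 2) (N + 1)) (-N - 1) (N + 1))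
    (z := e (N + 1) (N + 1)) (x := e (-N - 1) (N + 1) + 1) (y := e (-N - 2) (N + 1) - 1)
    (e₁ := e) (e₂ := e) (by
      intros; simp only [inc, dec, and_true, if_true]; split_ifs <;> omega) (by
      intros; simp only [inc, dec, and_true, if_true]; split_ifs <;> omega) (by
      intros; simp only [inc, dec, and_true, if_true]; split_ifs <;> omega) (by
      intros; simp only [inc, dec, and_true, if_true]; split_ifs <;> omega) (by
      intros; simp only [inc, dec, and_true, if_true]; split_ifs <;> omega)
  have hmod₂ := fun s (hs : s < 2 * N + 1) =>
    PL_fullList_smul' N (e := inc (dec e (-N + s) (N + 1)) (-N + s) N)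
    (z := e (N + 1) (N + 1)) (x := e (-N - 1) (N + 1)) (y := e (-N - 2) (N + 1))
    (e₁ := dec e (-N + s) (N + 1)) (e₂ := inc e (-N + s) N)
    (by
      intros; simp only [inc, dec, and_true, if_true]; split_ifs <;> omega) (by
      intros; simp only [inc, dec, and_true, if_true]; split_ifs <;> omega) (by
      intros; simp only [inc, dec, and_true, if_true]; split_ifs <;> omega) (by
      intros; simp only [inc, dec, and_true, if_true]; split_ifs <;> omega) (by
      intros; simp only [inc, dec, and_true, if_true]; split_ifs <;> omega)
  have hmod₃ := PL_fullList_smul' N (e := inc (dec e (-N - 1) (N + 1)) (-N - 1) N)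
    (z := e (N + 1) (N + 1)) (x := e (-N - 1) (N + 1) - 1) (y := e (-N - 2) (N + 1))
    (e₁ := e) (e₂ := inc e (-N - 1) N) (by
      intros; simp only [inc, dec, and_true, if_true]; split_ifs <;> omega) (by
      intros; simp only [inc, dec, and_true, if_true]; split_ifs <;> omega) (by
      intros; simp only [inc, dec, and_true, if_true]; split_ifs <;> omega) (by
      intros; simp only [inc, dec, and_true, if_true]; split_ifs <;> omega) (by
      intros; simp only [inc, dec, and_true, if_true]; split_ifs <;> omega)
  have hmod₄ := PL_fullList_smul' N (e := dec e (N + 1) (N + 1))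
    (z := e (N + 1) (N + 1) - 1) (x := e (-N - 1) (N + 1)) (y := e (-N - 2) (N + 1))
    (e₁ := e) (e₂ := e) (dec_self ..) (by
      intros; simp only [inc, dec, and_true, if_true]; split_ifs <;> omega) (by
      intros; simp only [inc, dec, and_true, if_true]; split_ifs <;> omega) (by
      intros; simp only [inc, dec, and_true, if_true]; split_ifs <;> omega) (by
      intros; simp only [inc, dec, and_true, if_true]; split_ifs <;> omega)
  rw [hmod₁, hmod₃, hmod₄]
  congr 1
  · congr 2
    refine Finset.sum_congr rfl fun s hs => ?_
    rw [Finset.mem_range] at hs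
    rw [hmod₂ s hs]
    congr 1
    rw [tw, ← Finset.sum_range_add_sum_Ico (fun s' : ℕ => e (-N + s') N) (show s + 1 ≤ 2 * N + 1 by omega),
      Finset.sum_sub_distrib]
    generalize ∑ s' ∈ Finset.range (s + 1), e (-N + s') (N + 1) = S₁
    generalize ∑ s' ∈ Finset.range (s + 1), e (-N + s') N = S₂
    generalize ∑ s' ∈ Finset.Ico (s + 1) (2 * N + 1), e (-N + s') N = S₃
    rw [show 1 + 2 * e (-N - 1) N - 2 * e (-N - 2) (N + 1) + (S₂ - S₁) = (1 - S₁) +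
      (0 * e (-N - 1) (N + 1) + -2 * e (-N - 2) (N + 1) + (S₂ + S₃ + 2 * e (-N - 1) N)) + -S₃
      by ring, zpow_add₀ hq _ (-S₃), zpow_add₀ hq (1 - S₁)]
    ring
  · congr 1
    rw [tw, ← zpow_add₀ hq, Finset.sum_sub_distrib]
    congr 1
    ring

end LowerRows

section RankOne

attribute [local instance] algebraNatK algebraIntK

theorem PL_fullList_one (e : ℤ → ℤ → ℤ) :
    PL (fullList 1) e = spow 0 0 (e 0 0) * spow (-1) 0 (e (-1) 0) := by
  rw [fullList, fullList, List.append_nil, fullRow, dl, dl, dl, PL_cons, PL_cons, PL_nil, mul_one]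
  simp

/-- The action of `E_{-1}` on a PBW monomial in the first row. -/
theorem eE_zero_smul {e : ℤ → ℤ → ℤ} (he : ∀ a b, 0 ≤ e a b) :
    eE 0 • PL (fullList 1) e • phi =
      ((1 - q ^ 2) * qint (e 0 0 + 1) * q ^ (1 + e 0 0 - 2 * e (-1) 0)) •
        PL (fullList 1) (inc (dec e (-1) 0) 0 0) • phi +
      q ^ (-2 * e (-1) 0) • PL (fullList 1) (dec e 0 0) • phi := by
  have hq := q_ne_zero
  have hZ : eE 0 * spow 0 0 (e 0 0) = q ^ (e 0 0) • (spow 0 0 (e 0 0) * eE 0) +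
      (1 : K) • (spow 0 0 (e 0 0 - 1) * (1 * tT 0)) := by
    have h : eE 0 * fseg 0 0 = q ^ (1 : ℤ) • (fseg 0 0 * eE 0) + tT 0 := by
      rw [fseg_self]; exact eE_mul_ff_zero
    have := E_mul_dpow_right h (tT_fseg_of le_rfl (by simp [cform])) (he 0 0)
    rw [← spow_of_ne (by omega), ← spow_of_ne (by omega), sub_self, zero_mul, zpow_zero,
      one_mul] at this
    rw [this, one_mul]
  have hY : eE 0 • spow (-1) 0 (e (-1) 0) • phi =
      ((1 - q ^ 2) * q ^ (1 - 2 * e (-1) 0)) • fseg 0 0 • spow (-1) 0 (e (-1) 0 - 1) • phi := by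
    rw [spow_of_eq (by rfl), spow_of_eq (by rfl)]
    refine E_mul_dpow_even (V := Vt) (t := 0) eE_fseg_sym_zero (fseg_same_last (by omega) le_rfl)
      (QComm.symm ((QComm.symm ?_).smul_right _)|>.congr (neg_neg _)) (tT_fseg_of (by omega) (by simp [cform])) (eE_smul_phi 0)
      (by rw [tT_smul_phi, zpow_zero, one_smul]) ?_ (he _ _)
    · rw [← fseg_self]
      exact fseg_same_first (b := -1) le_rfl
    · rw [smul_assoc, ff_smul_phi, fseg_self, sub_zero, zpow_neg_one]
      rfl
  have h := two_block_smul (V := Vt) hZ hY (spow_mul_self' (by omega) (he 0 0))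
    (spow_qcomm (tT_fseg_of (n := 0) (a := -1) (b := 0) (e := -2) (by omega) (by simp [cform]))
      (he (-1) 0)) (τ := 0) (by rw [tT_smul_phi, zpow_zero, one_smul])
    (by simp [QComm]) (μ := 1) (u' := phi) (by rw [one_smul, one_smul])
  rw [PL_fullList_one, PL_fullList_one, PL_fullList_one, dec_self,
    dec_of_ne _ (a := -1) (b := 0) (by omega), inc_self, inc_of_ne _ (by omega), dec_self,
    dec_of_ne _ (by omega), h]
  congr 2
  · rw [show 1 + e 0 0 - 2 * e (-1) 0 = e 0 0 + (1 - 2 * e (-1) 0) by ring, zpow_add₀ hq]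
    ring
  · rw [one_mul, mul_one, add_zero]

end RankOne

section Monomials

attribute [local instance] algebraNatK algebraIntK

/-- The decreasing PBW order. -/
def PBWGT (p p' : ℤ × ℤ) : Prop := p'.2 < p.2 ∨ p'.2 = p.2 ∧ p'.1 < p.1

theorem eq_of_pairwise_PBWGT {L L' : List (ℤ × ℤ)} (h : L.Pairwise PBWGT) (h' : L'.Pairwise PBWGT)
    (hm : ∀ p, p ∈ L ↔ p ∈ L') : L = L' := by
  have hn : ∀ {p p' : ℤ × ℤ}, PBWGT p p' → p ≠ p' := by
    rintro p p' (h | h) rfl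
    · exact lt_irrefl _ h
    · exact lt_irrefl _ h.2
  refine List.Perm.eq_of_pairwise (le := PBWGT) (fun a b _ _ hab hba => ?_) h h'
    ((List.perm_ext_iff_of_nodup (h.imp hn) (h'.imp hn)).mpr hm)
  unfold PBWGT at hab hba
  omega

theorem prod_map_filter_of_eq_one {α M : Type*} [Monoid M] {L : List α} {f : α → M} (P : α → Prop)
    (h : ∀ x ∈ L, ¬ P x → f x = 1) :
    ((L.filter (P ·)).map f).prod = (L.map f).prod := by
  induction L with
  | nil => rfl
  | cons x L ih =>
    have ih := ih fun y hy => h y (List.mem_cons_of_mem _ hy)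
    by_cases hx : P x
    · simp [hx, ih]
    · simp [hx, ih, h x List.mem_cons_self hx]

theorem box_eq (N : ℕ) : box N = (List.range (2 * N + 1)).flatMap fun a : ℕ =>
    (List.range (2 * N + 1)).map fun b : ℕ => ((N : ℤ) - b, (N : ℤ) - a) := by
  have h : ∀ L : List ℕ, (do let a ← L; pure (a : ℤ)) = L.map fun a : ℕ => (a : ℤ) := by
    intro L
    rw [List.bind_eq_flatMap]
    exact List.flatMap_pure_eq_map _ L
  rw [box, h, List.flatMap_map]
  simp only [List.map_map]
  rfl

theorem pairwise_box (N : ℕ) : (box N).Pairwise PBWGT := by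
  rw [box_eq, List.pairwise_flatMap]
  refine ⟨fun a _ => ?_, ?_⟩
  · rw [List.pairwise_map]
    refine List.pairwise_lt_range.imp fun h => Or.inr ⟨rfl, ?_⟩
    dsimp only
    omega
  · refine List.pairwise_lt_range.imp fun {a b} h x hx y hy => Or.inl ?_
    rw [List.mem_map] at hx hy
    obtain ⟨_, _, rfl⟩ := hx
    obtain ⟨_, _, rfl⟩ := hy
    dsimp only
    omega

theorem mem_box {N : ℕ} {p : ℤ × ℤ} : p ∈ box N ↔ p.1.natAbs ≤ N ∧ p.2.natAbs ≤ N := by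
  obtain ⟨x, y⟩ := p
  simp only [box_eq, List.mem_flatMap, List.mem_map, List.mem_range, Prod.mk.injEq]
  constructor
  · rintro ⟨a, ha, b, hb, rfl, rfl⟩
    omega
  · rintro ⟨h, h'⟩
    exact ⟨(N - y).toNat, by omega, (N - x).toNat, by omega, by omega, by omega⟩

theorem pairwise_dl (lo b : ℤ) (len : ℕ) : (dl lo b len).Pairwise PBWGT := by
  induction len with
  | zero => exact List.Pairwise.nil
  | succ len ih =>
    refine List.Pairwise.cons (fun p hp => Or.inr ?_) ih
    have := mem_dl.mp hp
    dsimp only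
    omega

theorem pairwise_fullList (N : ℕ) : (fullList N).Pairwise PBWGT := by
  induction N with
  | zero => exact List.Pairwise.nil
  | succ N ih =>
    refine List.pairwise_append.mpr ⟨pairwise_dl _ _ _, ih, fun p hp p' hp' => Or.inl ?_⟩
    have h := mem_dl.mp hp
    have h' := mem_fullList.mp hp'
    omega

/-- The multiplicities of a multisegment, in terms of the halved indices. -/
def mult (m : MS) (a b : ℤ) : ℤ := m (2 * a + 1, 2 * b + 1)

/-- The indices of the segments in the first `N` rows cover the support of `m`. -/
def Covers (N : ℕ) (m : MS) : Prop :=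
  ∀ i j : ℤ, m (i, j) ≠ 0 → ∃ a b : ℤ, i = 2 * a + 1 ∧ j = 2 * b + 1 ∧ (a, b) ∈ fullList N

theorem natAbs_le_bound {m : MS} {p : ℤ × ℤ} (h : m p ≠ 0) :
    p.1.natAbs ≤ bound m ∧ p.2.natAbs ≤ bound m := by
  have := Finset.le_sup (f := fun p : ℤ × ℤ => max p.1.natAbs p.2.natAbs)
    (Finsupp.mem_support_iff.mpr h)
  exact max_le_iff.mp this

theorem segPowM_zero (i j : ℤ) : segPowM i j 0 = 1 := by
  simp [segPowM, segPow, qfact]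

theorem Ptheta_eq_PL {N : ℕ} {m : MS} (hm : Covers N m) :
    Ptheta m = PL (fullList N) (mult m) := by
  rw [Ptheta]
  split_ifs with h
  · have hmap : PL (fullList N) (mult m) = (((fullList N).map fun p =>
        (2 * p.1 + 1, 2 * p.2 + 1)).map fun p => segPowM p.1 p.2 (m p)).prod := by
      rw [PL, List.map_map]
      congr 1
      exact List.map_congr_left fun p _ => (segPowM_eq_spow _ _ _).symm
    have hone : ∀ p : ℤ × ℤ, ¬ m p ≠ 0 → segPowM p.1 p.2 (m p) = 1 := by
      intro p hp
      rw [not_not.mp hp, segPowM_zero]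
    rw [hmap, PthetaProd, ← prod_map_filter_of_eq_one (fun p => m p ≠ 0) fun p _ => hone p,
      ← prod_map_filter_of_eq_one (L := (fullList N).map _) (fun p => m p ≠ 0) fun p _ => hone p]
    congr 2
    refine eq_of_pairwise_PBWGT ((pairwise_box _).filter _) (List.Pairwise.filter _
      (List.pairwise_map.mpr ((pairwise_fullList N).imp fun h => ?_))) fun p => ?_
    · unfold PBWGT at *
      dsimp only
      omega
    · simp only [List.mem_filter, decide_eq_true_eq]
      refine and_congr_left fun hp => ⟨fun _ => ?_, fun _ => mem_box.mpr (natAbs_le_bound hp)⟩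
      obtain ⟨a, b, h₁, h₂, h₃⟩ := hm p.1 p.2 hp
      exact List.mem_map.mpr ⟨(a, b), h₃, by rw [← h₁, ← h₂]⟩
  · rw [IsTheta] at h
    push Not at h
    obtain ⟨i, j, hij, h⟩ := h
    obtain ⟨a, b, rfl, rfl, hab⟩ := hm i j hij
    have h' := mem_fullList.mp hab
    have hneg : m (2 * a + 1, 2 * b + 1) < 0 :=
      lt_of_le_of_ne (h ⟨a, rfl⟩ ⟨b, rfl⟩ (by omega) (by omega)) hij
    exact (List.prod_eq_zero (List.mem_map.mpr ⟨(a, b), hab, spow_of_neg _ _ hneg⟩)).symm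

theorem mult_sub_sg (m : MS) (a b : ℤ) :
    mult (m - sg (2 * a + 1) (2 * b + 1)) = dec (mult m) a b := by
  funext x y
  rw [mult, dec, mult, sg, Finsupp.sub_apply, Finsupp.single_apply]
  congr 1
  refine if_congr ?_ rfl rfl
  rw [Prod.mk.injEq]
  omega

theorem mult_add_sg (m : MS) (a b : ℤ) :
    mult (m + sg (2 * a + 1) (2 * b + 1)) = inc (mult m) a b := by
  funext x y
  rw [mult, inc, mult, sg, Finsupp.add_apply, Finsupp.single_apply]
  congr 1
  refine if_congr ?_ rfl rfl
  rw [Prod.mk.injEq]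
  omega

theorem Covers.sub_sg {N : ℕ} {m : MS} (h : Covers N m) {a b : ℤ} (hab : (a, b) ∈ fullList N) :
    Covers N (m - sg (2 * a + 1) (2 * b + 1)) := by
  intro i j hij
  by_cases hm : m (i, j) = 0
  · rw [Finsupp.sub_apply, hm, zero_sub, neg_ne_zero, sg, Finsupp.single_apply_ne_zero,
      Prod.mk.injEq] at hij
    exact ⟨a, b, hij.1.1, hij.1.2, hab⟩
  · exact h i j hm

theorem Covers.add_sg {N : ℕ} {m : MS} (h : Covers N m) {a b : ℤ} (hab : (a, b) ∈ fullList N) :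
    Covers N (m + sg (2 * a + 1) (2 * b + 1)) := by
  intro i j hij
  by_cases hm : m (i, j) = 0
  · rw [Finsupp.add_apply, hm, zero_add, sg, Finsupp.single_apply_ne_zero,
      Prod.mk.injEq] at hij
    exact ⟨a, b, hij.1.1, hij.1.2, hab⟩
  · exact h i j hm

theorem Ptheta_sub_sg {N : ℕ} {m : MS} (h : Covers N m) {a b : ℤ} (hab : (a, b) ∈ fullList N) :
    Ptheta (m - sg (2 * a + 1) (2 * b + 1)) = PL (fullList N) (dec (mult m) a b) := by
  rw [Ptheta_eq_PL (h.sub_sg hab), mult_sub_sg]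

theorem Ptheta_sub_add_sg {N : ℕ} {m : MS} (h : Covers N m) {a b a' b' : ℤ}
    (hab : (a, b) ∈ fullList N) (hab' : (a', b') ∈ fullList N) :
    Ptheta (m - sg (2 * a + 1) (2 * b + 1) + sg (2 * a' + 1) (2 * b' + 1)) =
      PL (fullList N) (inc (dec (mult m) a b) a' b') := by
  rw [Ptheta_eq_PL ((h.sub_sg hab).add_sg hab'), mult_add_sg, mult_sub_sg]

theorem IsTheta.exists_covers {m : MS} (h : IsTheta m) (n : ℕ) : ∃ R : ℕ, Covers (n + 1 + R) m := by
  refine ⟨bound m, fun i j hij => ?_⟩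
  obtain ⟨⟨a, rfl⟩, ⟨b, rfl⟩, h₁, h₂, -⟩ := h i j hij
  have := (natAbs_le_bound hij).2
  refine ⟨a, b, rfl, rfl, mem_fullList.mpr ?_⟩
  dsimp only at this
  push_cast
  omega

theorem IsTheta.mult_nonneg {m : MS} (h : IsTheta m) (a b : ℤ) : 0 ≤ mult m a b := by
  by_contra hn
  have := (h (2 * a + 1) (2 * b + 1) (by rw [mult] at hn; omega)).2.2.2.2
  rw [mult] at hn
  omega

end Monomials

section Action

attribute [local instance] algebraNatK algebraIntK

theorem finsum_eq_sum_of_odd {M : Type*} [AddCommMonoid M] (lo : ℤ) (s : Finset ℕ) (f : ℤ → M)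
    (h : ∀ l, f l ≠ 0 → ∃ t ∈ s, l = 2 * (lo + t) + 1) :
    ∑ᶠ l, f l = ∑ t ∈ s, f (2 * (lo + t) + 1) := by
  rw [finsum_eq_sum_of_support_subset f (s := s.image fun t : ℕ => 2 * (lo + t) + 1)]
  · refine Finset.sum_image fun x _ y _ hxy => ?_
    omega
  · intro l hl
    obtain ⟨t, ht, rfl⟩ := h l hl
    exact Finset.mem_coe.mpr (Finset.mem_image_of_mem _ ht)

theorem Ptheta_eq_zero_of_neg {m : MS} {i j : ℤ} (h : m (i, j) < 0) : Ptheta m = 0 :=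
  if_neg fun hm => absurd (hm i j h.ne).2.2.2.2 h.not_gt

theorem Covers.lt {N : ℕ} {m : MS} (h : Covers N m) {i b : ℤ} (hm : m (i, 2 * b + 1) ≠ 0) :
    b < N := by
  obtain ⟨a, b', -, hb, hab⟩ := h i _ hm
  have := mem_fullList.mp hab
  omega

section Upper

variable {n R : ℕ} {m : MS} (hc : Covers (n + 1 + R) m)
include hc

theorem finsum_upper_of_le {k : ℤ} (hk : k = 2 * n + 1) (t : ℕ) :
    (∑ᶠ l : ℤ, if Odd l ∧ 2 * (n + 1 + t : ℤ) + 1 ≤ l then m (-k + 2, l) - m (-k, l) else 0) =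
      ∑ s ∈ Finset.Ico t R, (mult m (-n) (n + 1 + s) - mult m (-n - 1) (n + 1 + s)) := by
  rw [finsum_eq_sum_of_odd (n + 1) (Finset.Ico t R)]
  · refine Finset.sum_congr rfl fun s hs => ?_
    rw [Finset.mem_Ico] at hs
    rw [if_pos ⟨⟨_, rfl⟩, by omega⟩, mult, mult, hk, show -(2 * (n : ℤ) + 1) + 2 = 2 * -n + 1 by ring,
      show -(2 * (n : ℤ) + 1) = 2 * (-n - 1) + 1 by ring]
  · intro l hl
    have h := (ite_ne_right_iff.mp hl).1
    obtain ⟨⟨b, rfl⟩, hb⟩ := h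
    rw [if_pos ⟨⟨b, rfl⟩, hb⟩] at hl
    have : b < (n + 1 + R : ℕ) := by
      by_contra hn
      have h₀ : ∀ i, m (i, 2 * b + 1) = 0 := fun i => by
        by_contra h'
        exact hn (hc.lt h')
      rw [h₀, h₀] at hl
      exact hl rfl
    push_cast at this
    exact ⟨(b - n - 1).toNat, Finset.mem_Ico.mpr (by omega), by omega⟩

theorem finsum_upper {k : ℤ} (hk : k = 2 * n + 1) :
    (∑ᶠ l : ℤ, if Odd l ∧ k < l then m (-k + 2, l) - m (-k, l) else 0) =
      ∑ s ∈ Finset.range R, (mult m (-n) (n + 1 + s) - mult m (-n - 1) (n + 1 + s)) := by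
  rw [Finset.range_eq_Ico, ← finsum_upper_of_le hc hk]
  refine finsum_congr fun l => if_congr (and_congr_right ?_) rfl rfl
  rintro ⟨b, rfl⟩
  push_cast
  omega

theorem finsum_upper_smul {k : ℤ} (hk : k = 2 * n + 1) :
    (∑ᶠ l : ℤ, if Odd l ∧ k < l then
        ((1 - q ^ 2) * qint (m (-k + 2, l) + 1) *
          q ^ (1 + ∑ᶠ l' : ℤ, if Odd l' ∧ l ≤ l' then m (-k + 2, l') - m (-k, l') else 0)) •
          (Ptheta (m - sg (-k) l + sg (-k + 2) l) • phi)
       else 0) =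
      ∑ t ∈ Finset.range R, ((1 - q ^ 2) * qint (mult m (-n) (n + 1 + t) + 1) *
        q ^ (1 + ∑ s ∈ Finset.Ico t R,
          (mult m (-n) (n + 1 + s) - mult m (-n - 1) (n + 1 + s)))) •
        PL (fullList (n + 1 + R)) (inc (dec (mult m) (-n - 1) (n + 1 + t)) (-n) (n + 1 + t)) •
          phi := by
  have h₁ : -k + 2 = 2 * -n + 1 := by omega
  have h₂ : -k = 2 * (-n - 1) + 1 := by omega
  rw [finsum_eq_sum_of_odd (n + 1) (Finset.range R)]
  · refine Finset.sum_congr rfl fun t ht => ?_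
    rw [Finset.mem_range] at ht
    rw [if_pos ⟨⟨_, rfl⟩, by omega⟩, finsum_upper_of_le hc hk, h₁, h₂,
      Ptheta_sub_add_sg hc (mem_fullList.mpr (by push_cast; omega))
        (mem_fullList.mpr (by push_cast; omega))]
    rfl
  · intro l hl
    have h := (ite_ne_right_iff.mp hl).1
    obtain ⟨⟨b, rfl⟩, hb⟩ := h
    rw [if_pos ⟨⟨b, rfl⟩, hb⟩] at hl
    have : b < (n + 1 + R : ℕ) := by
      by_contra hn
      have h₀ : m (-k, 2 * b + 1) = 0 := by
        by_contra h'
        exact hn (hc.lt h')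
      refine hl ?_
      rw [Ptheta_eq_zero_of_neg (i := -k) (j := 2 * b + 1), zero_smul]
      · exact smul_zero (M := K) (A := Vt) _
      · rw [Finsupp.add_apply, Finsupp.sub_apply, h₀, sg, sg, Finsupp.single_eq_same,
          Finsupp.single_eq_of_ne]
        · norm_num
        · rw [Ne, Prod.mk.injEq]; omega
    push_cast at this
    exact ⟨(b - n - 1).toNat, Finset.mem_range.mpr (by omega), by omega⟩

end Upper

theorem PL_upperList_smul {n : ℕ} (R : ℕ) {e e' : ℤ → ℤ → ℤ}
    (h : ∀ a b : ℤ, n < b → e a b = e' a b) :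
    PL (upperList n R) e • PL (fullList (n + 1)) e' • phi =
      PL (fullList (n + 1 + R)) e' • phi := by
  rw [fullList_eq, PL_append, mul_smul,
    PL_congr (L := upperList n R) (e' := e') fun a b hab => h a b (mem_upperList hab).1]
  rfl

theorem eE_smul_fullList_add {n R : ℕ} {e : ℤ → ℤ → ℤ} (he : ∀ a b, 0 ≤ e a b) :
    eE n • PL (fullList (n + 1 + R)) e • phi =
      ∑ t ∈ Finset.range R, ((1 - q ^ 2) * qint (e (-n) (n + 1 + t) + 1) *
        q ^ (1 + ∑ s ∈ Finset.Ico t R, (e (-n) (n + 1 + s) - e (-n - 1) (n + 1 + s)))) •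
        PL (fullList (n + 1 + R)) (inc (dec e (-n - 1) (n + 1 + t)) (-n) (n + 1 + t)) • phi +
      q ^ (∑ s ∈ Finset.range R, (e (-n) (n + 1 + s) - e (-n - 1) (n + 1 + s))) •
        PL (upperList n R) e • eE n • PL (fullList (n + 1)) e • phi := by
  rw [← PL_upperList_smul R (e := e) (e' := e) fun _ _ _ => rfl, smul_smul (_ : U) (_ : U),
    E_mul_upperList n he R, add_smul, add_comm]
  congr 1
  · rw [Finset.sum_smul]
    refine Finset.sum_congr rfl fun t _ => ?_
    rw [smul_assoc, ← PL_upperList_smul R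
      (e := inc (dec e (-n - 1) (n + 1 + t)) (-n) (n + 1 + t)) fun _ _ _ => rfl]
    congr 2
    rw [PL_congr (L := fullList (n + 1))
      (e' := inc (dec e (-n - 1) (n + 1 + t)) (-n) (n + 1 + t))]
    intro a b hab
    rw [mem_fullList] at hab
    push_cast at hab
    rw [inc_of_ne _ (by omega), dec_of_ne _ (by omega)]
  · rw [smul_assoc, mul_smul]

end Action

section Action

attribute [local instance] algebraNatK algebraIntK

theorem zpow_mul_smul_smul {A V : Type*} [Ring A] [Algebra K A] [AddCommGroup V] [Module K V]
    [Module A V] [IsScalarTower K A V] (S x : ℤ) (c : K) (P : A) (u : V) :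
    q ^ S • P • (c * q ^ x) • u = (c * q ^ (S + x)) • P • u := by
  rw [smul_comm P (_ : K), smul_smul (_ : K) (_ : K), zpow_add₀ q_ne_zero]
  congr 1
  ring

theorem add_add_four {V : Type*} [AddCommGroup V] (x a b c d : V) :
    x + (a + b + c + d) = x + a + b + c + d := by
  abel

theorem smul_smul_add (S : ℤ) (P : U) (x y : Vt) :
    q ^ S • P • (x + y) = q ^ S • P • x + q ^ S • P • y := by
  rw [smul_add (M := U) (A := Vt), smul_add (M := K) (A := Vt)]

theorem smul_smul_sum (S : ℤ) (P : U) (s : Finset ℕ) (f : ℕ → Vt) :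
    q ^ S • P • ∑ i ∈ s, f i = ∑ i ∈ s, q ^ S • P • f i := by
  rw [Finset.smul_sum (M := U) (N := Vt), Finset.smul_sum (M := K) (N := Vt)]

theorem smul_upperList {n : ℕ} (R : ℕ) {e e' : ℤ → ℤ → ℤ} (S x : ℤ) (c : K)
    (h : ∀ a b : ℤ, n < b → e a b = e' a b) :
    q ^ S • PL (upperList n R) e • (c * q ^ x) • PL (fullList (n + 1)) e' • phi =
      (c * q ^ (S + x)) • PL (fullList (n + 1 + R)) e' • phi := by
  refine (zpow_mul_smul_smul (A := U) (V := Vt) S x c _ _).trans ?_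
  rw [PL_upperList_smul R h]

theorem smul_upperList' {n : ℕ} (R : ℕ) {e e' : ℤ → ℤ → ℤ} (S x : ℤ)
    (h : ∀ a b : ℤ, n < b → e a b = e' a b) :
    q ^ S • PL (upperList n R) e • q ^ x • PL (fullList (n + 1)) e' • phi =
      q ^ (S + x) • PL (fullList (n + 1 + R)) e' • phi := by
  have := smul_upperList R S x 1 h
  rwa [one_mul, one_mul] at this

theorem E_neg_one_action {m : MS} (hm : IsTheta m) :
    (Ee (-1) * Ptheta m) • phi =
      (∑ᶠ l : ℤ, if Odd l ∧ 1 < l then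
        ((1 - q ^ 2) * qint (m (-1 + 2, l) + 1) *
          q ^ (1 + ∑ᶠ l' : ℤ, if Odd l' ∧ l ≤ l' then m (-1 + 2, l') - m (-1, l') else 0)) •
          (Ptheta (m - sg (-1) l + sg (-1 + 2) l) • phi)
       else 0)
      + ((1 - q ^ 2) * qint (m (-1 + 2, 1) + 1) *
          q ^ (1 + (∑ᶠ l' : ℤ, if Odd l' ∧ 1 < l' then m (-1 + 2, l') - m (-1, l') else 0)
               + m (-1 + 2, 1) - 2 * m (-1, 1))) •
          (Ptheta (m - sg (-1) 1 + sg (-1 + 2) 1) • phi)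
      + (q ^ ((∑ᶠ l' : ℤ, if Odd l' ∧ 1 < l' then m (-1 + 2, l') - m (-1, l') else 0)
              - 2 * m (-1, 1))) •
          (Ptheta (m - sg 1 1) • phi) := by
  obtain ⟨R, hc⟩ := hm.exists_covers 0
  have hk : (1 : ℤ) = 2 * (0 : ℕ) + 1 := rfl
  have he := hm.mult_nonneg
  rw [finsum_upper_smul hc hk, finsum_upper hc hk, Ptheta_eq_PL hc, mul_smul]
  generalize hS : ∑ s ∈ Finset.range R, (mult m (-(0 : ℕ)) ((0 : ℕ) + 1 + s) -
    mult m (-(0 : ℕ) - 1) ((0 : ℕ) + 1 + s)) = S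
  have h := eE_smul_fullList_add (n := 0) (R := R) he
  have h₁ := Ptheta_sub_add_sg hc (a := -1) (b := 0) (a' := 0) (b' := 0)
    (mem_fullList.mpr (by omega)) (mem_fullList.mpr (by omega))
  have h₂ := Ptheta_sub_sg hc (a := 0) (b := 0) (mem_fullList.mpr (by omega))
  rw [hS, Nat.cast_zero, zero_add, eE_zero_smul he, smul_smul_add, smul_upperList (n := 0) R S _ _ ?_,
    smul_upperList' (n := 0) R S _ ?_, ← add_assoc] at h
  · refine h.trans ?_
    congr 1
    · congr 1
      rw [← h₁]
      congr 2
      rw [add_sub, ← add_assoc, add_comm S 1]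
      rfl
    · rw [← h₂]
      congr 2
      rw [neg_mul, ← sub_eq_add_neg]
      rfl
  · intro a b hb
    rw [dec_of_ne _ (by omega)]
  · intro a b hb
    rw [inc_of_ne _ (by omega), dec_of_ne _ (by omega)]

theorem E_neg_action_of_ne_one {N : ℕ} {k : ℤ} (hk : k = 2 * N + 3) {m : MS} (hm : IsTheta m) :
    (Ee (-k) * Ptheta m) • phi =
      (∑ᶠ l : ℤ, if Odd l ∧ k < l then
        ((1 - q ^ 2) * qint (m (-k + 2, l) + 1) *
          q ^ (1 + ∑ᶠ l' : ℤ, if Odd l' ∧ l ≤ l' then m (-k + 2, l') - m (-k, l') else 0)) •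
          (Ptheta (m - sg (-k) l + sg (-k + 2) l) • phi)
       else 0)
      + ((1 - q ^ 2) * qint (m (-k + 2, k) + 1) *
          q ^ (1 + (∑ᶠ l' : ℤ, if Odd l' ∧ k < l' then m (-k + 2, l') - m (-k, l') else 0)
               + m (-k + 2, k) - 2 * m (-k, k))) •
          (Ptheta (m - sg (-k) k + sg (-k + 2) k) • phi)
      + (∑ᶠ i : ℤ, if Odd i ∧ -k + 2 < i ∧ i ≤ k - 2 then
          ((1 - q ^ 2) * qint (m (i, k - 2) + 1) *
            q ^ (1 + (∑ᶠ l' : ℤ, if Odd l' ∧ k < l' then m (-k + 2, l') - m (-k, l') else 0)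
                 + 2 * m (-k + 2, k - 2) - 2 * m (-k, k)
                 + (∑ᶠ i' : ℤ, if Odd i' ∧ -k + 2 < i' ∧ i' ≤ i then
                      m (i', k - 2) - m (i', k) else 0))) •
            (Ptheta (m - sg i k + sg i (k - 2)) • phi)
         else 0)
      + ((1 - q ^ 2) * qint (2 * (m (-k + 2, k - 2) + 1)) *
            q ^ (1 + (∑ᶠ l' : ℤ, if Odd l' ∧ k < l' then m (-k + 2, l') - m (-k, l') else 0)
                 + 2 * m (-k + 2, k - 2) - 2 * m (-k, k))) •
            (Ptheta (m - sg (-k + 2) k + sg (-k + 2) (k - 2)) • phi)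
      + (q ^ ((∑ᶠ l' : ℤ, if Odd l' ∧ k < l' then m (-k + 2, l') - m (-k, l') else 0)
              - 2 * m (-k, k)
              + (1 - m (k, k) + 2 * m (-k + 2, k - 2)
                  + (∑ᶠ i : ℤ, if Odd i ∧ -k + 2 < i ∧ i ≤ k - 2 then
                       m (i, k - 2) - m (i, k) else 0)))) •
          (Ptheta (m - sg k k) • phi) := by
  obtain ⟨R, hc⟩ := hm.exists_covers (N + 1)
  have hk' : k = 2 * (N + 1 : ℕ) + 1 := by push_cast; omega
  have he := hm.mult_nonneg
  have hmid : ∀ s < 2 * N + 1,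
      (∑ᶠ i : ℤ, if Odd i ∧ -k + 2 < i ∧ i ≤ 2 * (-N + s) + 1 then
        m (i, k - 2) - m (i, k) else 0) =
      ∑ s' ∈ Finset.range (s + 1),
        (mult m (-N + s') N - mult m (-N + s') (N + 1)) := by
    intro s _
    rw [finsum_eq_sum_of_odd (-N) (Finset.range (s + 1))]
    · refine Finset.sum_congr rfl fun s' hs => ?_
      rw [Finset.mem_range] at hs
      rw [if_pos ⟨⟨_, rfl⟩, by omega⟩, mult, mult, hk]
      congr 3 <;> ring
    · intro i hi
      obtain ⟨⟨a, rfl⟩, ha⟩ := (ite_ne_right_iff.mp hi).1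
      exact ⟨(a + N).toNat, Finset.mem_range.mpr (by omega), by omega⟩
  rw [finsum_upper_smul hc hk', finsum_upper hc hk',
    finsum_eq_sum_of_odd (-N) (Finset.range (2 * N + 1)), Ptheta_eq_PL hc, mul_smul]
  swap
  · intro i hi
    obtain ⟨⟨a, rfl⟩, ha⟩ := (ite_ne_right_iff.mp hi).1
    exact ⟨(a + N).toNat, Finset.mem_range.mpr (by omega), by omega⟩
  generalize hS : ∑ s ∈ Finset.range R, (mult m (-(N + 1 : ℕ)) ((N + 1 : ℕ) + 1 + s) -
    mult m (-(N + 1 : ℕ) - 1) ((N + 1 : ℕ) + 1 + s)) = S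
  have h := eE_smul_fullList_add (n := N + 1) (R := R) he
  have hlow := eE_smul_lower he N
  have hcast : ((N + 1 : ℕ) : ℤ) = N + 1 := by push_cast; rfl
  have hEk : Ee (-k) = eE ((N + 1 : ℕ) : ℤ) := by rw [hk', eE]
  rw [hEk]
  rw [hS, hcast, show N + 1 + 1 = N + 2 by rfl, hlow] at h
  simp only [smul_smul_add, smul_smul_sum] at h
  have hlast := hmid (2 * N) (by omega)
  rw [show 2 * (-(N : ℤ) + ((2 * N : ℕ) : ℤ)) + 1 = k - 2 by push_cast; omega] at hlast
  have hk₀ : -k = 2 * (-N - 2) + 1 := by omega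
  have hk₁ : -k + 2 = 2 * (-N - 1) + 1 := by omega
  have hk₂ : k - 2 = 2 * N + 1 := by omega
  have hk₃ : k = 2 * (N + 1) + 1 := by omega
  have hA := smul_upperList (n := N + 1) R S
    (1 + mult m (-N - 1) (N + 1) - 2 * mult m (-N - 2) (N + 1))
    ((1 - q ^ 2) * qint (mult m (-N - 1) (N + 1) + 1)) (e := mult m)
    (e' := inc (dec (mult m) (-N - 2) (N + 1)) (-N - 1) (N + 1)) fun a b hb => by
      rw [inc_of_ne _ (by omega), dec_of_ne _ (by omega)]
  have hC := smul_upperList (n := N + 1) R S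
    (1 + 2 * mult m (-N - 1) N - 2 * mult m (-N - 2) (N + 1))
    ((1 - q ^ 2) * qint (2 * (mult m (-N - 1) N + 1))) (e := mult m)
    (e' := inc (dec (mult m) (-N - 1) (N + 1)) (-N - 1) N) fun a b hb => by
      rw [inc_of_ne _ (by omega), dec_of_ne _ (by omega)]
  have hD := smul_upperList' (n := N + 1) R S
    (1 - mult m (N + 1) (N + 1) - 2 * mult m (-N - 2) (N + 1) + 2 * mult m (-N - 1) N +
      ∑ s ∈ Finset.range (2 * N + 1), (mult m (-N + s) N - mult m (-N + s) (N + 1)))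
    (e := mult m) (e' := dec (mult m) (N + 1) (N + 1)) fun a b hb => by
      rw [dec_of_ne _ (by omega)]
  rw [hcast]
  refine h.trans ((add_add_four _ _ _ _ _).trans ?_)
  refine congrArg₂ _ (congrArg₂ _ (congrArg₂ _ (congrArg₂ _ ?_ ?_) ?_) ?_) ?_
  · refine Finset.sum_congr rfl fun t _ => ?_
    rw [show -(N + 1 : ℤ) = -N - 1 by ring]
  · rw [hk₁, hk₀, hk₃, Ptheta_sub_add_sg hc (mem_fullList.mpr (by omega))
        (mem_fullList.mpr (by omega))]
    refine hA.trans ?_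
    rw [add_sub, ← add_assoc, add_comm S 1]
    rfl
  · refine Finset.sum_congr rfl fun s hs => ?_
    rw [Finset.mem_range] at hs
    rw [if_pos ⟨⟨_, rfl⟩, by omega⟩, hmid s hs, hk₁, hk₂, hk₀, hk₃,
      Ptheta_sub_add_sg hc (mem_fullList.mpr (by omega)) (mem_fullList.mpr (by omega))]
    refine (smul_upperList (n := N + 1) R S _ _ fun a b hb => ?_).trans ?_
    · rw [inc_of_ne _ (by omega), dec_of_ne _ (by omega)]
    · generalize ∑ s' ∈ Finset.range (s + 1), (mult m (-N + s') N - mult m (-N + s') (N + 1)) = S'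
      rw [← add_assoc, add_sub, ← add_assoc, add_comm S 1]
      rfl
  · rw [hk₁, hk₂, hk₀, hk₃, Ptheta_sub_add_sg hc (mem_fullList.mpr (by omega))
        (mem_fullList.mpr (by omega))]
    refine hC.trans ?_
    rw [add_sub, ← add_assoc, add_comm S 1]
    rfl
  · rw [hlast, hk₁, hk₂, hk₀, hk₃, Ptheta_sub_sg hc (mem_fullList.mpr (by omega))]
    refine hD.trans ?_
    congr 2
    simp only [mult]
    ring

end Action

/-- Theorem 3.22 of Enomoto–Kashiwara: the action of `E_{−k}` on `P_θ(m)φ̃`. -/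
theorem E_neg_action_on_PBW (k : ℤ) (hk : Odd k) (hkpos : 0 < k)
    (m : MS) (hm : IsTheta m) :
    (Ee (-k) * Ptheta m) • phi =
      (∑ᶠ l : ℤ, if Odd l ∧ k < l then
        ((1 - q ^ 2) * qint (m (-k + 2, l) + 1) *
          q ^ (1 + ∑ᶠ l' : ℤ, if Odd l' ∧ l ≤ l' then m (-k + 2, l') - m (-k, l') else 0)) •
          (Ptheta (m - sg (-k) l + sg (-k + 2) l) • phi)
       else 0)
      + ((1 - q ^ 2) * qint (m (-k + 2, k) + 1) *
          q ^ (1 + (∑ᶠ l' : ℤ, if Odd l' ∧ k < l' then m (-k + 2, l') - m (-k, l') else 0)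
               + m (-k + 2, k) - 2 * m (-k, k))) •
          (Ptheta (m - sg (-k) k + sg (-k + 2) k) • phi)
      + (∑ᶠ i : ℤ, if Odd i ∧ -k + 2 < i ∧ i ≤ k - 2 then
          ((1 - q ^ 2) * qint (m (i, k - 2) + 1) *
            q ^ (1 + (∑ᶠ l' : ℤ, if Odd l' ∧ k < l' then m (-k + 2, l') - m (-k, l') else 0)
                 + 2 * m (-k + 2, k - 2) - 2 * m (-k, k)
                 + (∑ᶠ i' : ℤ, if Odd i' ∧ -k + 2 < i' ∧ i' ≤ i then
                      m (i', k - 2) - m (i', k) else 0))) •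
            (Ptheta (m - sg i k + sg i (k - 2)) • phi)
         else 0)
      + (if k ≠ 1 then
          ((1 - q ^ 2) * qint (2 * (m (-k + 2, k - 2) + 1)) *
            q ^ (1 + (∑ᶠ l' : ℤ, if Odd l' ∧ k < l' then m (-k + 2, l') - m (-k, l') else 0)
                 + 2 * m (-k + 2, k - 2) - 2 * m (-k, k))) •
            (Ptheta (m - sg (-k + 2) k + sg (-k + 2) (k - 2)) • phi)
         else 0)
      + (q ^ ((∑ᶠ l' : ℤ, if Odd l' ∧ k < l' then m (-k + 2, l') - m (-k, l') else 0)
              - 2 * m (-k, k)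
              + (if k ≠ 1 then
                  1 - m (k, k) + 2 * m (-k + 2, k - 2)
                  + (∑ᶠ i : ℤ, if Odd i ∧ -k + 2 < i ∧ i ≤ k - 2 then
                       m (i, k - 2) - m (i, k) else 0)
                 else 0))) •
          (Ptheta (m - sg k k) • phi) := by
  by_cases h : k = 1
  · subst h
    have hmid (f : ℤ → Vt) : (∑ᶠ i : ℤ, if Odd i ∧ -1 + 2 < i ∧ i ≤ 1 - 2 then f i else 0) = 0 :=
      finsum_eq_zero_of_forall_eq_zero fun i => if_neg (by omega)
    rw [E_neg_one_action hm, hmid, if_neg (not_not.mpr rfl), if_neg (not_not.mpr rfl), add_zero,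
      add_zero, add_zero]
  · rw [if_pos h, if_pos h]
    obtain ⟨a, rfl⟩ := hk
    exact E_neg_action_of_ne_one (N := (a - 1).toNat) (by omega) hm

end
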